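/- arXiv:2505.15258 — 4 statements merged into one kernel-verified Lean document; each statement's English description precedes it below -/
import Mathlib

section
/- With K ⊆ 𝕂 as constructed, let α = Σ_{ℓ≥1} t^{−π₀/p^ℓ}, β = Σ_{ℓ≥1} t^{−(p+1)/p^ℓ} ∈ 𝕂 and θ = α + tβ. Then θ is algebraic over K with [K(θ):K] = p², K(θ) = K(α, β), the roots of the minimal polynomial of θ over K are exactly the elements θ + i·t + j with (i,j) ∈ 𝔽_p², and the set {v(θ' − θ) : θ' a K-conjugate of θ, θ' ≠ θ} equals {0, 1}; in particular #S_θ = 2. -/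
/-! Setup: `k` is an algebraic closure of `𝔽_p`, `𝕂 = k((t^ℝ))` the Hahn series field with
its canonical valuation `v = HahnSeries.addVal`.  Fix `π₀ ∈ ℝ` and a strictly increasing
sequence `(r_i)_{i ≥ 1}` with `r_1 = p` such that `{π₀} ∪ {r_i}` is ℚ-linearly independent.
`a_ℓ = t^{-π₀/p^ℓ}`, `b_ℓ = t^{-1/r_ℓ} - t^{-1/r_{ℓ+1}}`, `K_ℓ` is the subfield of `𝕂`
generated by `k ∪ {t, t^{π₀}, a_1, …, a_ℓ, b_1, …, b_ℓ}` and `K = ⋃_ℓ K_ℓ`. -/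

/-- The Hahn series field `k((t^ℝ))` over the algebraic closure `k` of `𝔽_p`. -/
abbrev HahnF (p : ℕ) [Fact p.Prime] : Type :=
  HahnSeries ℝ (AlgebraicClosure (ZMod p))

/-- `a_ℓ = t^{-π₀/p^ℓ}`. -/
noncomputable def aElt (p : ℕ) [Fact p.Prime] (π₀ : ℝ) (ℓ : ℕ) : HahnF p :=
  HahnSeries.single (-π₀ / (p : ℝ) ^ ℓ) 1

/-- `b_ℓ = t^{-1/r_ℓ} - t^{-1/r_{ℓ+1}}`. -/
noncomputable def bElt (p : ℕ) [Fact p.Prime] (r : ℕ → ℝ) (ℓ : ℕ) : HahnF p :=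
  HahnSeries.single (-1 / r ℓ) 1 - HahnSeries.single (-1 / r (ℓ + 1)) 1

/-- `K = ⋃_{ℓ ≥ 1} K_ℓ`: the subfield of `𝕂` generated by
`k ∪ {t, t^{π₀}} ∪ {a_ℓ, b_ℓ : ℓ ≥ 1}`. -/
noncomputable def KBig (p : ℕ) [Fact p.Prime] (π₀ : ℝ) (r : ℕ → ℝ) : Subfield (HahnF p) :=
  Subfield.closure
    (Set.range (HahnSeries.C : AlgebraicClosure (ZMod p) →+* HahnF p) ∪
      {HahnSeries.single (1 : ℝ) 1, HahnSeries.single π₀ 1} ∪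
      {x | ∃ j, 1 ≤ j ∧ (x = aElt p π₀ j ∨ x = bElt p r j)})

open Polynomial IntermediateField in
/-- A field generated by roots of two Artin–Schreier polynomials is Galois. -/
theorem isGalois_adjoin_pair_of_pow_sub_mem {p : ℕ} [Fact p.Prime] {F L : Type*} [Field F] [Field L]
    [Algebra F L] [CharP L p] {α β : L} (hα : α ^ p - α ∈ (algebraMap F L).range)
    (hβ : β ^ p - β ∈ (algebraMap F L).range) :
    FiniteDimensional F (adjoin F {α, β}) ∧ IsGalois F (adjoin F {α, β}) := by
  have hp : p.Prime := Fact.out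
  have hcF : CharP F p := (RingHom.charP_iff (algebraMap F L) (algebraMap F L).injective p).2 ‹_›
  obtain ⟨a, ha⟩ := hα
  obtain ⟨b, hb⟩ := hβ
  let P : F → F[X] := fun c ↦ X ^ p - X - C c
  have hdeg : ∀ c, (P c).Monic := fun c ↦ by
    have : P c = X ^ p - (X + C c) := by simp only [P]; ring
    rw [this]
    refine monic_X_pow_sub ?_
    rw [degree_X_add_C]
    exact_mod_cast hp.one_lt
  have hsep : ∀ c, (P c).Separable := fun c ↦ by
    refine ⟨0, -1, ?_⟩
    simp [P, derivative_X_pow]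
  have hsplit : ∀ (c : F) (x : L), algebraMap F L c = x ^ p - x →
      ((P c).map (algebraMap F L)).Splits := fun c x hx ↦ by
    have h1 : (X ^ p - X : L[X]).Splits := by
      have := (Subfield.splits_bot L p).map (Subfield.subtype (⊥ : Subfield L))
      simpa using this
    have h2 : (P c).map (algebraMap F L) = (X ^ p - X : L[X]).comp (X - C x) := by
      simp only [P, Polynomial.map_sub, Polynomial.map_pow, map_X, map_C, hx, sub_comp, pow_comp,
        X_comp, sub_pow_char, ← C_pow, C_sub]
      ring
    rw [h2]
    exact h1.comp_X_sub_C x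
  have hroot : ∀ (c : F) (x : L), algebraMap F L c = x ^ p - x → aeval x (P c) = 0 := by
    intro c x hx
    simp [P, hx]
  have hEq : adjoin F {α, β} = adjoin F ((P a * P b).rootSet L) := by
    have hne : P a * P b ≠ 0 := ((hdeg a).mul (hdeg b)).ne_zero
    have key : ∀ (c : F) (x y : L), algebraMap F L c = x ^ p - x → aeval y (P c) = 0 →
        x ∈ adjoin F {α, β} → y ∈ adjoin F {α, β} := by
      intro c x y hx hy hxm
      have h1 : (y - x) ^ p = y - x := by
        simp only [P, map_sub, map_pow, aeval_X, aeval_C, hx] at hy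
        rw [sub_pow_char]
        linear_combination hy
      have h2 : y - x ∈ (⊥ : Subfield L) := (Subfield.mem_bot_iff_pow_eq_self L p).2 h1
      have h3 : y - x ∈ adjoin F {α, β} :=
        (bot_le : (⊥ : Subfield L) ≤ (adjoin F {α, β}).toSubfield) h2
      simpa using add_mem h3 hxm
    apply le_antisymm
    · rw [adjoin_le_iff]
      rintro x (rfl | rfl)
      · exact subset_adjoin _ _ ((mem_rootSet_of_ne hne).2 (by simp [hroot a _ ha]))
      · exact subset_adjoin _ _ ((mem_rootSet_of_ne hne).2 (by simp [hroot b _ hb]))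
    · rw [adjoin_le_iff]
      intro x hx
      rw [mem_rootSet_of_ne hne, map_mul, mul_eq_zero] at hx
      rcases hx with hx | hx
      · exact key a α x ha hx (subset_adjoin _ _ (by simp))
      · exact key b β x hb hx (subset_adjoin _ _ (by simp))
  have hint : ∀ (c : F) (x : L), algebraMap F L c = x ^ p - x → IsSeparable F x := fun c x hx ↦
    (hsep c).of_dvd (minpoly.dvd F x (hroot c x hx))
  have hS : Algebra.IsSeparable F (adjoin F {α, β}) := by
    rw [isSeparable_adjoin_iff_isSeparable]
    rintro x (rfl | rfl)
    · exact hint a _ ha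
    · exact hint b _ hb
  have hsf : (P a * P b).IsSplittingField F (adjoin F {α, β}) := by
    rw [hEq]
    refine adjoin_rootSet_isSplittingField ?_
    rw [Polynomial.map_mul]
    exact (hsplit a α ha).mul (hsplit b β hb)
  have hN : Normal F (adjoin F {α, β}) := Normal.of_isSplittingField (P a * P b)
  exact ⟨IsSplittingField.finiteDimensional _ (P a * P b), ⟨⟩⟩

/-- In a Galois extension generated by two Artin–Schreier roots that are independent modulo the
base field, every pair of translations by elements of the prime field is an automorphism. -/
theorem artinSchreier_pair_automorphisms {p : ℕ} [Fact p.Prime] {F E : Type*} [Field F] [Field E]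
    [Algebra F E] [CharP E p] [FiniteDimensional F E] [IsGalois F E] {a b : E}
    (ha : a ^ p - a ∈ (algebraMap F E).range) (hb : b ^ p - b ∈ (algebraMap F E).range)
    (hgen : IntermediateField.adjoin F {a, b} = ⊤)
    (hind : ∀ i j : ZMod p, ZMod.castHom dvd_rfl E i * a + ZMod.castHom dvd_rfl E j * b ∈
      (algebraMap F E).range → i = 0 ∧ j = 0) :
    Module.finrank F E ≤ p ^ 2 ∧ ∀ i j : ZMod p, ∃ σ : E ≃ₐ[F] E,
      σ a = a + ZMod.castHom dvd_rfl E i ∧ σ b = b + ZMod.castHom dvd_rfl E j := by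
  set ι : ZMod p →+* E := ZMod.castHom dvd_rfl E with hι
  have hfix : ∀ (σ : E ≃ₐ[F] E) i, σ (ι i) = ι i := fun σ i ↦
    RingHom.congr_fun (Subsingleton.elim ((σ : E →+* E).comp ι) ι) i
  have htrans : ∀ x : E, x ^ p - x ∈ (algebraMap F E).range → ∀ σ : E ≃ₐ[F] E,
      ∃ i, σ x = x + ι i := by
    rintro x ⟨c, hc⟩ σ
    have h0 : σ x ^ p - σ x = x ^ p - x := by
      rw [← map_pow, ← map_sub, ← hc, AlgEquiv.commutes]
    have h1 : (σ x - x) ^ p = σ x - x := by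
      rw [sub_pow_char]
      linear_combination h0
    have h2 : σ x - x ∈ (⊥ : Subfield E) := (Subfield.mem_bot_iff_pow_eq_self E p).2 h1
    obtain ⟨i, hi⟩ := (bot_le : (⊥ : Subfield E) ≤ ι.fieldRange) h2
    exact ⟨i, by rw [hi]; ring⟩
  choose u hu using htrans a ha
  choose w hw using htrans b hb
  constructor
  · rw [← IsGalois.card_aut_eq_finrank]
    have hinj : Function.Injective fun σ : E ≃ₐ[F] E ↦ (u σ, w σ) := by
      intro σ τ h
      obtain ⟨h1, h2⟩ := Prod.mk.inj h
      have hle : IntermediateField.adjoin F {a, b} ≤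
          IntermediateField.fixedField (Subgroup.zpowers (τ⁻¹ * σ)) := by
        have hτ : ∀ x, σ x = τ x → x ∈ IntermediateField.fixedField
            (Subgroup.zpowers (τ⁻¹ * σ)) := by
          intro x hx
          rw [IntermediateField.mem_fixedField_iff]
          intro f hf
          have hle : Subgroup.zpowers (τ⁻¹ * σ) ≤ MulAction.stabilizer (E ≃ₐ[F] E) x := by
            rw [Subgroup.zpowers_le, MulAction.mem_stabilizer_iff, mul_smul,
              inv_smul_eq_iff]
            exact hx
          exact hle hf
        rw [IntermediateField.adjoin_le_iff]
        rintro x (rfl | rfl)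
        · exact hτ _ (by rw [hu, hu, h1])
        · exact hτ _ (by rw [hw, hw, h2])
      rw [hgen] at hle
      ext x
      have hx := (IntermediateField.mem_fixedField_iff _ x).1
        (hle (IntermediateField.mem_top (x := x))) _ (Subgroup.mem_zpowers _)
      rw [AlgEquiv.mul_apply] at hx
      simpa using congrArg τ hx
    have := Nat.card_le_card_of_injective _ hinj
    simpa [sq] using this
  · let S : AddSubgroup (ZMod p × ZMod p) :=
      { carrier := {v | ∃ σ : E ≃ₐ[F] E, σ a = a + ι v.1 ∧ σ b = b + ι v.2}
        zero_mem' := ⟨1, by simp⟩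
        add_mem' := by
          rintro v v' ⟨σ, h1, h2⟩ ⟨τ, h3, h4⟩
          refine ⟨σ * τ, ?_, ?_⟩
          · simp only [AlgEquiv.mul_apply, h3, map_add, h1, hfix, Prod.fst_add]; ring
          · simp only [AlgEquiv.mul_apply, h4, map_add, h2, hfix, Prod.snd_add]; ring
        neg_mem' := by
          rintro v ⟨σ, h1, h2⟩
          refine ⟨σ.symm, ?_, ?_⟩
          · rw [AlgEquiv.symm_apply_eq, map_add, h1, hfix]; simp
          · rw [AlgEquiv.symm_apply_eq, map_add, h2, hfix]; simp }
    have htop : AddSubgroup.toZModSubmodule p S = ⊤ := by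
      by_contra hne
      obtain ⟨f, hf0, hf⟩ := Submodule.exists_le_ker_of_lt_top _ (lt_top_iff_ne_top.2 hne)
      have hfv : ∀ v, f v = f (1, 0) * v.1 + f (0, 1) * v.2 := by
        intro v
        have : v = v.1 • (1, 0) + v.2 • (0, 1) := by ext <;> simp
        conv_lhs => rw [this]
        simp only [map_add, map_smul, smul_eq_mul]
        ring
      have hmem : ι (f (1, 0)) * a + ι (f (0, 1)) * b ∈ (algebraMap F E).range := by
        have : ι (f (1, 0)) * a + ι (f (0, 1)) * b ∈ (⊥ : IntermediateField F E) := by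
          rw [IsGalois.mem_bot_iff_fixed]
          intro σ
          have hk : f (u σ, w σ) = 0 := hf (show (u σ, w σ) ∈ S from ⟨σ, hu σ, hw σ⟩)
          rw [hfv] at hk
          have hk' := congrArg ι hk
          simp only [map_add, map_mul, map_zero] at hk'
          rw [map_add, map_mul, map_mul, hfix, hfix, hu, hw]
          linear_combination hk'
        exact IntermediateField.mem_bot.1 this
      obtain ⟨h1, h2⟩ := hind _ _ hmem
      apply hf0
      ext <;> simp [h1, h2]
    intro i j
    have : (i, j) ∈ AddSubgroup.toZModSubmodule p S := htop ▸ Submodule.mem_top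
    exact this

open IntermediateField in
/-- Two independent Artin–Schreier roots `α`, `β`, combined along a base element `τ` outside the
prime field, have primitive element `α + τ β`, whose conjugates are its translates by the
`𝔽_p`-span of `1` and `τ`. -/
theorem artinSchreier_pair_primitive {p : ℕ} [Fact p.Prime] {F L : Type*} [Field F] [Field L]
    [Algebra F L] [CharP L p] {α β τ : L} (hα : α ^ p - α ∈ (algebraMap F L).range)
    (hβ : β ^ p - β ∈ (algebraMap F L).range) (hτ : τ ∈ (algebraMap F L).range)
    (hτp : ∀ i : ZMod p, ZMod.castHom dvd_rfl L i ≠ τ)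
    (hind : ∀ i j : ZMod p, ZMod.castHom dvd_rfl L i * α + ZMod.castHom dvd_rfl L j * β ∈
      (algebraMap F L).range → i = 0 ∧ j = 0) :
    IsAlgebraic F (α + τ * β) ∧
    Module.finrank F (adjoin F {α + τ * β}) = p ^ 2 ∧
    adjoin F {α + τ * β} = adjoin F {α, β} ∧
    {x : L | Polynomial.aeval x (minpoly F (α + τ * β)) = 0} =
      {x : L | ∃ i j : ZMod p, x = α + τ * β + ZMod.castHom dvd_rfl L i * τ +
        ZMod.castHom dvd_rfl L j} := by
  classical
  obtain ⟨hfd, hgal⟩ := isGalois_adjoin_pair_of_pow_sub_mem hα hβ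
  set E := adjoin F {α, β} with hE
  set ι := ZMod.castHom dvd_rfl L with hι
  set θ := α + τ * β with hθ
  have hcE : CharP E p := (RingHom.charP_iff (algebraMap E L) (algebraMap E L).injective p).2 ‹_›
  have hcast : ∀ i, ((ZMod.castHom dvd_rfl E i : E) : L) = ι i := fun i ↦
    RingHom.congr_fun (Subsingleton.elim ((algebraMap E L).comp (ZMod.castHom dvd_rfl E)) ι) i
  have hαE : α ∈ E := subset_adjoin _ _ (by simp)
  have hβE : β ∈ E := subset_adjoin _ _ (by simp)
  obtain ⟨t, ht⟩ := hτ
  have hrange : ∀ x : E, (x : L) ∈ (algebraMap F L).range → x ∈ (algebraMap F E).range := by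
    rintro x ⟨c, hc⟩
    exact ⟨c, Subtype.ext hc⟩
  have hgen : adjoin F {(⟨α, hαE⟩ : E), ⟨β, hβE⟩} = ⊤ := by
    apply map_injective E.val
    rw [adjoin_map, ← AlgHom.fieldRange_eq_map, fieldRange_val, Set.image_pair]
    rfl
  obtain ⟨hle, hσ⟩ := artinSchreier_pair_automorphisms (p := p) (a := (⟨α, hαE⟩ : E))
    (b := ⟨β, hβE⟩) (hrange _ (by simpa using hα)) (hrange _ (by simpa using hβ)) hgen
    (by
      rintro i j ⟨c, hc⟩
      refine hind i j ⟨c, ?_⟩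
      have := congrArg (algebraMap E L) hc
      simpa [hcast, ← IsScalarTower.algebraMap_apply, -ZMod.castHom_apply] using! this)
  have hτE : τ ∈ E := ht ▸ E.algebraMap_mem t
  have hθE : θ ∈ E := add_mem hαE (mul_mem hτE hβE)
  have hθint : IsIntegral F θ := by
    have := (IsIntegral.of_finite F (⟨θ, hθE⟩ : E)).map E.val
    exact this
  have hsub : adjoin F {θ} ≤ E := by
    rw [adjoin_simple_le_iff]
    exact hθE
  have hne := minpoly.ne_zero hθint
  let c : ZMod p × ZMod p → L := fun v ↦ θ + ι v.1 * τ + ι v.2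
  have hcinj : Function.Injective c := by
    rintro ⟨i, j⟩ ⟨i', j'⟩ h
    have h1 : ι (i - i') * τ = ι (j' - j) := by
      simp only [c] at h
      simp only [map_sub]
      linear_combination h
    have h2 : i - i' = 0 := by
      by_contra h0
      apply hτp ((i - i')⁻¹ * (j' - j))
      rw [map_mul, ← h1, ← mul_assoc, ← map_mul, inv_mul_cancel₀ h0, map_one, one_mul]
    have h3 : ι (j' - j) = 0 := by rw [← h1, h2, map_zero, zero_mul]
    rw [map_eq_zero] at h3
    rw [sub_eq_zero.1 h2, (sub_eq_zero.1 h3)]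
  have hcroot : ∀ v, Polynomial.aeval (c v) (minpoly F θ) = 0 := by
    rintro ⟨i, j⟩
    obtain ⟨σ, h1, h2⟩ := hσ j i
    have h3 : ((σ ⟨θ, hθE⟩ : E) : L) = c (i, j) := by
      have : (⟨θ, hθE⟩ : E) = ⟨α, hαE⟩ + algebraMap F E t * ⟨β, hβE⟩ := by
        apply Subtype.ext
        simp [hθ, ← ht]
      rw [this, map_add, map_mul, AlgEquiv.commutes, h1, h2]
      simp [hcast, c, hθ, ← ht, -ZMod.castHom_apply]
      ring
    have h4 := Polynomial.aeval_algHom_apply (E.val.comp (σ : E →ₐ[F] E)) ⟨θ, hθE⟩ (minpoly F θ)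
    have h5 : Polynomial.aeval (⟨θ, hθE⟩ : E) (minpoly F θ) = 0 := by
      apply Subtype.ext
      have := Polynomial.aeval_algHom_apply E.val ⟨θ, hθE⟩ (minpoly F θ)
      rw [ZeroMemClass.coe_zero, ← minpoly.aeval F θ]
      exact this.symm
    rw [h5, map_zero] at h4
    rw [← h3]
    exact h4
  have hcsub : Finset.univ.image c ⊆ ((minpoly F θ).aroots L).toFinset := by
    intro x hx
    obtain ⟨v, -, rfl⟩ := Finset.mem_image.1 hx
    rw [Multiset.mem_toFinset, Polynomial.mem_aroots]
    exact ⟨hne, hcroot v⟩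
  have hcard : (Finset.univ.image c).card = p ^ 2 := by
    rw [Finset.card_image_of_injective _ hcinj]
    simp [sq, ZMod.card]
  have hroots : ((minpoly F θ).aroots L).toFinset.card ≤ (minpoly F θ).natDegree :=
    (Multiset.toFinset_card_le _).trans ((Polynomial.card_roots' _).trans
      Polynomial.natDegree_map_le)
  have hfr : Module.finrank F (adjoin F {θ}) = (minpoly F θ).natDegree := adjoin.finrank hθint
  have hfr_le : Module.finrank F (adjoin F {θ}) ≤ Module.finrank F E :=
    finrank_le_of_le_right hsub
  have hge := Finset.card_le_card hcsub
  have hfrp : Module.finrank F (adjoin F {θ}) = p ^ 2 := by omega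
  refine ⟨hθint.isAlgebraic, hfrp, eq_of_le_of_finrank_le hsub (by omega), ?_⟩
  have heq := Finset.eq_of_subset_of_card_le hcsub (by omega)
  ext x
  constructor
  · intro hx
    have : x ∈ Finset.univ.image c := by
      rw [heq, Multiset.mem_toFinset, Polynomial.mem_aroots]
      exact ⟨hne, hx⟩
    obtain ⟨v, -, rfl⟩ := Finset.mem_image.1 this
    exact ⟨v.1, v.2, rfl⟩
  · rintro ⟨i, j, rfl⟩
    exact hcroot (i, j)

theorem HahnSeries.support_pow_subset_Ici {R : Type*} [CommRing R] {x : HahnSeries ℝ R} {a : ℝ}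
    (hx : x.support ⊆ Set.Ici a) (n : ℕ) : (x ^ n).support ⊆ Set.Ici (n * a) := by
  induction n with
  | zero =>
    intro g hg
    rw [pow_zero] at hg
    by_contra h
    exact hg (by rw [HahnSeries.coeff_one, if_neg (by rintro rfl; simp at h)])
  | succ n ih =>
    rw [pow_succ]
    refine HahnSeries.support_mul_subset.trans ?_
    rintro _ ⟨u, hu, v, hv, rfl⟩
    have h1 := ih hu
    have h2 := hx hv
    simp only [Set.mem_Ici] at h1 h2 ⊢
    push_cast
    linarith

theorem HahnSeries.support_pow_succ_subset_Iio {R : Type*} [CommRing R] {x : HahnSeries ℝ R}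
    (hx : x.support ⊆ Set.Iio 0) (n : ℕ) : (x ^ (n + 1)).support ⊆ Set.Iio 0 := by
  induction n with
  | zero => simpa using hx
  | succ n ih =>
    rw [pow_succ]
    refine HahnSeries.support_mul_subset.trans ?_
    rintro _ ⟨u, hu, v, hv, rfl⟩
    exact add_neg (Set.mem_Iio.1 (ih hu)) (Set.mem_Iio.1 (hx hv))

theorem exists_div_pow_lt {p : ℕ} (hp : p.Prime) (c : ℝ) {ε : ℝ} (hε : 0 < ε) :
    ∃ N : ℕ, ∀ n, N ≤ n → c / (p : ℝ) ^ n < ε := by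
  have h : Filter.Tendsto (fun n : ℕ ↦ c / (p : ℝ) ^ n) Filter.atTop (nhds 0) :=
    (tendsto_pow_atTop_atTop_of_one_lt (by exact_mod_cast hp.one_lt)).const_div_atTop c
  exact Filter.eventually_atTop.1 (h.eventually_lt_const hε)

/-- `∑_{ℓ ≥ 1} t^{-c/p^ℓ}` is an Artin–Schreier root of `t^{-c}`. -/
theorem HahnSeries.pow_sub_self_eq_single {p : ℕ} [Fact p.Prime] {R : Type*} [Field R] [CharP R p]
    {c : ℝ} (hc : 0 < c) {x : HahnSeries ℝ R}
    (hsupp : x.support = {g : ℝ | ∃ ℓ : ℕ, 1 ≤ ℓ ∧ g = -c / (p : ℝ) ^ ℓ})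
    (hcoeff : ∀ g ∈ x.support, x.coeff g = 1) : x ^ p - x = HahnSeries.single (-c) 1 := by
  classical
  have hp : p.Prime := Fact.out
  have hp1 : (1 : ℝ) < p := by exact_mod_cast hp.one_lt
  have hp0 : (0 : ℝ) < p := by linarith
  have : CharP (HahnSeries ℝ R) p :=
    (RingHom.charP_iff (HahnSeries.C : R →+* HahnSeries ℝ R) HahnSeries.C_injective p).1 ‹_›
  let e : ℕ → ℝ := fun ℓ ↦ -c / (p : ℝ) ^ ℓ
  have he : ∀ ℓ, p * e (ℓ + 1) = e ℓ := fun ℓ ↦ by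
    simp only [e, pow_succ]; field_simp
  have heneg : ∀ ℓ, e ℓ < 0 := fun ℓ ↦ div_neg_of_neg_of_pos (by linarith) (by positivity)
  have hmono : StrictMono e := strictMono_nat_of_lt_succ fun ℓ ↦ by
    have h1 := he ℓ
    have h2 := heneg (ℓ + 1)
    nlinarith
  let s : ℕ → HahnSeries ℝ R := fun n ↦ ∑ ℓ ∈ Finset.range n, HahnSeries.single (e (ℓ + 1)) 1
  have hs : ∀ n, s (n + 1) ^ p = HahnSeries.single (e 0) 1 + s n := fun n ↦ by
    simp only [s]
    rw [sum_pow_char, Finset.sum_range_succ']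
    simp only [HahnSeries.single_pow, one_pow, nsmul_eq_mul, he]
    rw [add_comm]
  have hxc : ∀ ℓ, x.coeff (e (ℓ + 1)) = 1 := fun ℓ ↦
    hcoeff _ (hsupp ▸ ⟨ℓ + 1, by omega, rfl⟩)
  have hT : ∀ n, (x - s n).support ⊆ {g | ∃ ℓ, n ≤ ℓ ∧ g = e (ℓ + 1)} := by
    intro n g hg
    rw [HahnSeries.mem_support, HahnSeries.coeff_sub, HahnSeries.coeff_sum] at hg
    by_cases h : g ∈ x.support
    · obtain ⟨ℓ, hℓ, rfl⟩ := hsupp ▸ h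
      obtain ⟨m, rfl⟩ : ∃ m, ℓ = m + 1 := ⟨ℓ - 1, by omega⟩
      refine ⟨m, ?_, rfl⟩
      by_contra! hlt
      apply hg
      change x.coeff (e (m + 1)) - ∑ i ∈ Finset.range n,
        (HahnSeries.single (e (i + 1)) (1 : R)).coeff (e (m + 1)) = 0
      rw [hxc, Finset.sum_eq_single m, HahnSeries.coeff_single_same, sub_self]
      · intro i _ hi
        exact HahnSeries.coeff_single_of_ne fun h ↦ hi (by have := hmono.injective h; omega)
      · intro h
        exact absurd (Finset.mem_range.2 hlt) h
    · exfalso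
      have hx0 : x.coeff g = 0 := by simpa using h
      apply hg
      rw [hx0, Finset.sum_eq_zero, sub_zero]
      intro i _
      refine HahnSeries.coeff_single_of_ne ?_
      rintro rfl
      exact h (hsupp ▸ ⟨i + 1, by omega, rfl⟩)
  have hz : ∀ n, x ^ p - x - HahnSeries.single (-c) 1 = (x - s (n + 1)) ^ p - (x - s n) := by
    intro n
    rw [sub_pow_char, hs]
    simp only [e, pow_zero, div_one]
    ring
  have hTneg : ∀ n, (x - s n).support ⊆ Set.Iio 0 := fun n g hg ↦ by
    obtain ⟨ℓ, -, rfl⟩ := hT n hg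
    exact heneg _
  have hTge : ∀ n, (x - s n).support ⊆ Set.Ici (e (n + 1)) := fun n g hg ↦ by
    obtain ⟨ℓ, h, rfl⟩ := hT n hg
    exact hmono.monotone (by omega)
  rw [← sub_eq_zero]
  ext g
  rw [HahnSeries.coeff_zero]
  obtain ⟨n, hn⟩ : ∃ n, g ∉ ((x - s (n + 1)) ^ p).support ∧ g ∉ (x - s n).support := by
    rcases lt_or_ge g 0 with hg | hg
    · obtain ⟨N, hN⟩ := exists_div_pow_lt hp c (neg_pos.2 hg)
      have h1 : g < e (N + 1) := by
        have := hN (N + 1) (by omega)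
        simp only [e, neg_div]
        linarith
      refine ⟨N, fun h ↦ ?_, fun h ↦ ?_⟩
      · have h2 := HahnSeries.support_pow_subset_Ici (hTge (N + 1)) p h
        rw [he, Set.mem_Ici] at h2
        linarith
      · have h2 := hTge N h
        rw [Set.mem_Ici] at h2
        linarith
    · obtain ⟨q, hq⟩ : ∃ q, p = q + 1 := ⟨p - 1, by have := hp.pos; omega⟩
      refine ⟨0, fun h ↦ ?_, fun h ↦ ?_⟩
      · have h2 := HahnSeries.support_pow_succ_subset_Iio (hTneg 1) q (hq ▸ h)
        exact absurd h2 (not_lt.2 hg)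
      · exact absurd (hTneg 0 h) (not_lt.2 hg)
  rw [hz n, HahnSeries.coeff_sub]
  simp only [HahnSeries.mem_support, not_not] at hn
  rw [hn.1, hn.2, sub_zero]

/-- The elements of a Hahn series field that are quotients of finitely supported series. -/
theorem HahnSeries.exists_finite_support_of_mem_closure {R : Type*} [Field R]
    {S : Set (HahnSeries ℝ R)} (hS : ∀ x ∈ S, x.support.Finite) {x : HahnSeries ℝ R}
    (hx : x ∈ Subfield.closure S) :
    ∃ P Q : HahnSeries ℝ R, P.support.Finite ∧ Q.support.Finite ∧ Q ≠ 0 ∧ Q * x = P := by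
  have hadd : ∀ {f g : HahnSeries ℝ R}, f.support.Finite → g.support.Finite →
      (f + g).support.Finite := fun hf hg ↦
    (hf.union hg).subset (HahnSeries.support_add_subset _ _)
  have hmul : ∀ {f g : HahnSeries ℝ R}, f.support.Finite → g.support.Finite →
      (f * g).support.Finite := fun hf hg ↦
    (hf.add hg).subset HahnSeries.support_mul_subset
  have hone : (1 : HahnSeries ℝ R).support.Finite := by simp
  induction hx using Subfield.closure_induction with
  | mem x hx => exact ⟨x, 1, hS x hx, hone, one_ne_zero, one_mul x⟩
  | one => exact ⟨1, 1, hone, hone, one_ne_zero, one_mul 1⟩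
  | add x y _ _ hx hy =>
    obtain ⟨P, Q, hP, hQ, hQ0, rfl⟩ := hx
    obtain ⟨P', Q', hP', hQ', hQ0', rfl⟩ := hy
    exact ⟨Q' * (Q * x) + Q * (Q' * y), Q * Q', hadd (hmul hQ' hP) (hmul hQ hP'), hmul hQ hQ',
      mul_ne_zero hQ0 hQ0', by ring⟩
  | neg x _ hx =>
    obtain ⟨P, Q, hP, hQ, hQ0, rfl⟩ := hx
    exact ⟨-(Q * x), Q, by simpa using hP, hQ, hQ0, by ring⟩
  | inv x _ hx =>
    obtain ⟨P, Q, hP, hQ, hQ0, rfl⟩ := hx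
    rcases eq_or_ne x 0 with rfl | hx0
    · exact ⟨0, 1, by simp, hone, one_ne_zero, by simp⟩
    · exact ⟨Q, Q * x, hQ, hP, mul_ne_zero hQ0 hx0, by field_simp⟩
  | mul x y _ _ hx hy =>
    obtain ⟨P, Q, hP, hQ, hQ0, rfl⟩ := hx
    obtain ⟨P', Q', hP', hQ', hQ0', rfl⟩ := hy
    exact ⟨(Q * x) * (Q' * y), Q * Q', hmul hP hP', hmul hQ hQ', mul_ne_zero hQ0 hQ0', by ring⟩

/-- A series with negative support accumulating at `0` is not a quotient of finitely supported
series. -/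
theorem HahnSeries.mul_support_infinite {R : Type*} [Field R] {Q x : HahnSeries ℝ R}
    (hQ : Q.support.Finite) (hQ0 : Q ≠ 0) (hx : x.support ⊆ Set.Iio 0) {e : ℕ → ℝ}
    (hinj : Function.Injective e) (he : ∀ n, e n ∈ x.support)
    (hlim : ∀ ε > 0, ∃ N, ∀ n, N ≤ n → -ε < e n) : (Q * x).support.Infinite := by
  obtain ⟨q, hq, hmax⟩ := hQ.exists_maximal (HahnSeries.support_nonempty_iff.2 hQ0)
  have hmax' : ∀ q' ∈ Q.support, q' ≤ q := fun q' hq' ↦ by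
    rcases le_total q' q with h | h
    · exact h
    · exact hmax hq' h
  obtain ⟨ε, hε, hgap⟩ : ∃ ε > 0, ∀ q' ∈ Q.support, q' ≠ q → q' ≤ q - ε := by
    rcases (Q.support \ {q}).eq_empty_or_nonempty with h | h
    · refine ⟨1, one_pos, fun q' hq' hne ↦ ?_⟩
      have : q' ∈ Q.support \ {q} := ⟨hq', hne⟩
      simp [h] at this
    · obtain ⟨m, hm, hmm⟩ := (hQ.subset Set.sdiff_subset).exists_maximal h
      refine ⟨q - m, sub_pos.2 (lt_of_le_of_ne (hmax' m hm.1) hm.2), fun q' hq' hne ↦ ?_⟩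
      rcases le_total q' m with h | h
      · linarith
      · linarith [hmm ⟨hq', hne⟩ h]
  obtain ⟨N, hN⟩ := hlim ε hε
  refine Set.infinite_of_injective_forall_mem (f := fun n ↦ q + e (n + N))
    (fun m n h ↦ by have := hinj (add_left_cancel h); omega) fun n ↦ ?_
  rw [HahnSeries.mem_support, HahnSeries.coeff_mul, Finset.sum_eq_single (q, e (n + N))]
  · exact mul_ne_zero hq (he _)
  · rintro ⟨u, v⟩ huv hne
    exfalso
    rw [Finset.mem_antidiagonal] at huv
    obtain ⟨hu, hv, huv⟩ := huv
    have h1 : v < 0 := hx hv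
    have h2 := hN (n + N) (by omega)
    simp only at huv
    by_cases h : u = q
    · subst h
      exact hne (by rw [add_left_cancel huv])
    · linarith [hgap u hu h]
  · intro h
    exact absurd (Finset.mem_antidiagonal.2 ⟨hq, he _, rfl⟩) h

theorem KBig_exists_finite_support {p : ℕ} [Fact p.Prime] {π₀ : ℝ} {r : ℕ → ℝ} {x : HahnF p}
    (hx : x ∈ KBig p π₀ r) :
    ∃ P Q : HahnF p, P.support.Finite ∧ Q.support.Finite ∧ Q ≠ 0 ∧ Q * x = P := by
  have hsingle : ∀ (g : ℝ) (c : AlgebraicClosure (ZMod p)),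
      (HahnSeries.single g c).support.Finite := fun g c ↦
    (Set.finite_singleton g).subset HahnSeries.support_single_subset
  refine HahnSeries.exists_finite_support_of_mem_closure ?_ hx
  rintro x ((⟨c, rfl⟩ | rfl | rfl) | ⟨j, -, rfl | rfl⟩)
  · exact hsingle 0 c
  · exact hsingle _ _
  · exact hsingle _ _
  · exact hsingle _ _
  · exact ((hsingle _ _).union (hsingle _ _)).subset (HahnSeries.support_sub_subset _ _)

/-- Series `∑ t^{-c/p^ℓ}` and `∑ t^{-d/p^ℓ}` with disjoint supports have no nontrivial
`𝔽_p`-linear relation modulo `K`. -/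
theorem KBig_artinSchreier_independent {p : ℕ} [Fact p.Prime] {π₀ : ℝ} {r : ℕ → ℝ} {c d : ℝ}
    (hc : 0 < c) (hd : 0 < d) (hcd : ∀ m n : ℕ, c / (p : ℝ) ^ m ≠ d / (p : ℝ) ^ n) {α β : HahnF p}
    (hα : α.support = {x : ℝ | ∃ ℓ : ℕ, 1 ≤ ℓ ∧ x = -c / (p : ℝ) ^ ℓ})
    (hβ : β.support = {x : ℝ | ∃ ℓ : ℕ, 1 ≤ ℓ ∧ x = -d / (p : ℝ) ^ ℓ})
    {i j : AlgebraicClosure (ZMod p)}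
    (h : HahnSeries.C i * α + HahnSeries.C j * β ∈ KBig p π₀ r) : i = 0 ∧ j = 0 := by
  have hp : p.Prime := Fact.out
  have hp1 : (1 : ℝ) < p := by exact_mod_cast hp.one_lt
  have hp0 : (0 : ℝ) < p := by linarith
  set x := HahnSeries.C i * α + HahnSeries.C j * β with hx
  have hxc : ∀ g, x.coeff g = i * α.coeff g + j * β.coeff g := fun g ↦ by
    simp [hx]
  have hneg : ∀ c : ℝ, 0 < c → ∀ ℓ : ℕ, -c / (p : ℝ) ^ ℓ < 0 := fun c hc ℓ ↦
    div_neg_of_neg_of_pos (by linarith) (by positivity)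
  have hxneg : x.support ⊆ Set.Iio 0 := by
    intro g hg
    by_contra hg0
    have h1 : g ∉ α.support := by
      rw [hα]
      rintro ⟨ℓ, -, rfl⟩
      exact hg0 (hneg c hc ℓ)
    have h2 : g ∉ β.support := by
      rw [hβ]
      rintro ⟨ℓ, -, rfl⟩
      exact hg0 (hneg d hd ℓ)
    rw [HahnSeries.mem_support, not_not] at h1 h2
    exact hg (by rw [hxc, h1, h2, mul_zero, mul_zero, add_zero])
  obtain ⟨P, Q, hP, hQ, hQ0, hQx⟩ := KBig_exists_finite_support h
  have key : ∀ c : ℝ, 0 < c → ¬ ∀ n : ℕ, -c / (p : ℝ) ^ (n + 1) ∈ x.support := by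
    intro c hc hmem
    refine HahnSeries.mul_support_infinite hQ hQ0 hxneg (e := fun n ↦ -c / (p : ℝ) ^ (n + 1))
      ?_ hmem ?_ (hQx ▸ hP)
    · intro m n hmn
      have h1 : (p : ℝ) ^ (m + 1) = (p : ℝ) ^ (n + 1) :=
        inv_injective (mul_left_cancel₀ (show -c ≠ 0 by linarith)
          (by simpa only [div_eq_mul_inv] using hmn))
      have := pow_right_injective₀ hp0 hp1.ne' h1
      omega
    · intro ε hε
      obtain ⟨N, hN⟩ := exists_div_pow_lt hp c hε
      refine ⟨N, fun n hn ↦ ?_⟩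
      rw [neg_div]
      linarith [hN (n + 1) (by omega)]
  constructor
  · by_contra hi
    refine key c hc fun n ↦ ?_
    have h1 : -c / (p : ℝ) ^ (n + 1) ∈ α.support := hα ▸ ⟨n + 1, by omega, rfl⟩
    have h2 : -c / (p : ℝ) ^ (n + 1) ∉ β.support := by
      rw [hβ]
      rintro ⟨ℓ, -, h⟩
      rw [neg_div, neg_div, neg_inj] at h
      exact hcd _ _ h
    rw [HahnSeries.mem_support, not_not] at h2
    rw [HahnSeries.mem_support, hxc, h2, mul_zero, add_zero]
    exact mul_ne_zero hi h1
  · by_contra hj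
    refine key d hd fun n ↦ ?_
    have h1 : -d / (p : ℝ) ^ (n + 1) ∈ β.support := hβ ▸ ⟨n + 1, by omega, rfl⟩
    have h2 : -d / (p : ℝ) ^ (n + 1) ∉ α.support := by
      rw [hα]
      rintro ⟨ℓ, -, h⟩
      rw [neg_div, neg_div, neg_inj] at h
      exact hcd _ _ h.symm
    rw [HahnSeries.mem_support, not_not] at h2
    rw [HahnSeries.mem_support, hxc, h2, mul_zero, zero_add]
    exact mul_ne_zero hj h1

theorem nonneg_of_support_eq {p : ℕ} [Fact p.Prime] {c : ℝ} {α : HahnF p}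
    (hα : α.support = {x : ℝ | ∃ ℓ : ℕ, 1 ≤ ℓ ∧ x = -c / (p : ℝ) ^ ℓ}) : 0 ≤ c := by
  have hp : p.Prime := Fact.out
  have hp1 : (1 : ℝ) < p := by exact_mod_cast hp.one_lt
  by_contra! hc
  have hne : α.support.Nonempty := hα ▸ ⟨_, 1, le_rfl, rfl⟩
  have hmem := α.isWF_support.min_mem hne
  obtain ⟨ℓ, hℓ, he⟩ := (Set.ext_iff.1 hα _).1 hmem
  have hmem' : -c / (p : ℝ) ^ (ℓ + 1) ∈ α.support := hα ▸ ⟨ℓ + 1, by omega, rfl⟩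
  have hle := α.isWF_support.min_le hne hmem'
  rw [he] at hle
  have : -c / (p : ℝ) ^ (ℓ + 1) < -c / (p : ℝ) ^ ℓ := by
    gcongr
    · linarith
    · omega
  linarith

set_option synthInstance.maxHeartbeats 1000000
set_option maxHeartbeats 1000000

/-- With `α = Σ_{ℓ≥1} t^{-π₀/p^ℓ}`, `β = Σ_{ℓ≥1} t^{-(p+1)/p^ℓ}` and
`θ = α + tβ`: `θ` is algebraic over `K` with `[K(θ):K] = p²`, `K(θ) = K(α,β)`, the roots of
the minimal polynomial of `θ` over `K` are exactly the `θ + i·t + j` with `(i,j) ∈ 𝔽_p²`,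
and `S_θ = {v(θ' - θ) : θ' ≠ θ a conjugate of θ} = {0, 1}`. -/
theorem statement5 (p : ℕ) [Fact p.Prime] (π₀ : ℝ) (r : ℕ → ℝ)
    (hr1 : r 1 = p) (hrmono : ∀ i, 1 ≤ i → r i < r (i + 1))
    (hind : LinearIndependent ℚ (fun i : ℕ => if i = 0 then π₀ else r i))
    (α β : HahnF p)
    (hαsupp : α.support = {x : ℝ | ∃ ℓ : ℕ, 1 ≤ ℓ ∧ x = -π₀ / (p : ℝ) ^ ℓ})
    (hαcoeff : ∀ x ∈ α.support, α.coeff x = 1)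
    (hβsupp : β.support = {x : ℝ | ∃ ℓ : ℕ, 1 ≤ ℓ ∧ x = -((p : ℝ) + 1) / (p : ℝ) ^ ℓ})
    (hβcoeff : ∀ x ∈ β.support, β.coeff x = 1)
    (θ : HahnF p) (hθ : θ = α + HahnSeries.single (1 : ℝ) 1 * β) :
    IsAlgebraic (KBig p π₀ r) θ ∧
    Module.finrank (KBig p π₀ r)
      ↥(IntermediateField.adjoin (KBig p π₀ r) {θ}) = p ^ 2 ∧
    IntermediateField.adjoin (KBig p π₀ r) {θ} =
      IntermediateField.adjoin (KBig p π₀ r) {α, β} ∧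
    {θ' : HahnF p | Polynomial.aeval θ' (minpoly (KBig p π₀ r) θ) = 0} =
      {x : HahnF p | ∃ i j : ZMod p,
        x = θ + (i.val : HahnF p) * HahnSeries.single (1 : ℝ) 1 + (j.val : HahnF p)} ∧
    {γ : WithTop ℝ | ∃ θ' : HahnF p,
        Polynomial.aeval θ' (minpoly (KBig p π₀ r) θ) = 0 ∧ θ' ≠ θ ∧
        HahnSeries.addVal ℝ (AlgebraicClosure (ZMod p)) (θ' - θ) = γ} =
      {(0 : WithTop ℝ), ((1 : ℝ) : WithTop ℝ)} := by
  have hp : p.Prime := Fact.out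
  have hp1 : (1 : ℝ) < p := by exact_mod_cast hp.one_lt
  have hp0 : (0 : ℝ) < p := by linarith
  have hchar : CharP (HahnF p) p := (RingHom.charP_iff
    (HahnSeries.C : AlgebraicClosure (ZMod p) →+* HahnF p) HahnSeries.C_injective p).1 inferInstance
  have hπ : 0 < π₀ := (nonneg_of_support_eq hαsupp).lt_of_ne' (by simpa using hind.ne_zero 0)
  have hcd : ∀ m n : ℕ, π₀ / (p : ℝ) ^ m ≠ ((p : ℝ) + 1) / (p : ℝ) ^ n := by
    intro m n h
    have h2 : LinearIndependent ℚ ![π₀, r 1] := by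
      have := hind.comp ![0, 1] (by decide)
      convert this using 1
      ext i
      fin_cases i <;> simp
    rw [LinearIndependent.pair_iff' (by simpa using hπ.ne')] at h2
    apply h2 ((p : ℚ) * p ^ n / ((p + 1) * p ^ m))
    rw [div_eq_div_iff (by positivity) (by positivity)] at h
    rw [hr1, Rat.smul_def]
    push_cast
    rw [div_mul_eq_mul_div, div_eq_iff (by positivity)]
    linear_combination (p : ℝ) * h
  set τ : HahnF p := HahnSeries.single (1 : ℝ) 1 with hτ
  have hcast : ∀ i : ZMod p, ZMod.castHom dvd_rfl (HahnF p) i =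
      HahnSeries.C (algebraMap (ZMod p) (AlgebraicClosure (ZMod p)) i) := fun i ↦
    RingHom.congr_fun (Subsingleton.elim (ZMod.castHom dvd_rfl (HahnF p))
      (HahnSeries.C.comp (algebraMap (ZMod p) (AlgebraicClosure (ZMod p))))) i
  have hval : ∀ i : ZMod p, (i.val : HahnF p) = ZMod.castHom dvd_rfl (HahnF p) i := fun i ↦ by
    rw [ZMod.castHom_apply, ZMod.natCast_val]
  have hmem : ∀ x ∈ KBig p π₀ r, x ∈ (algebraMap (KBig p π₀ r) (HahnF p)).range :=
    fun x hx ↦ ⟨⟨x, hx⟩, rfl⟩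
  have hτK : τ ∈ KBig p π₀ r := Subfield.subset_closure (by simp [hτ])
  have hpd : (0 : ℝ) < p + 1 := by linarith
  have hα : α ^ p - α ∈ (algebraMap (KBig p π₀ r) (HahnF p)).range := by
    refine hmem _ ?_
    rw [HahnSeries.pow_sub_self_eq_single hπ hαsupp hαcoeff]
    have h1 : HahnSeries.single π₀ 1 ∈ KBig p π₀ r := Subfield.subset_closure (by simp)
    simpa [HahnSeries.inv_single] using inv_mem h1
  have hβ : β ^ p - β ∈ (algebraMap (KBig p π₀ r) (HahnF p)).range := by
    refine hmem _ ?_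
    rw [HahnSeries.pow_sub_self_eq_single hpd hβsupp hβcoeff]
    have h1 := inv_mem (pow_mem hτK (p + 1))
    simpa [hτ, HahnSeries.inv_single] using h1
  have hcoeff : ∀ i j : ZMod p, ∀ g : ℝ, (ZMod.castHom dvd_rfl (HahnF p) i * τ +
      ZMod.castHom dvd_rfl (HahnF p) j).coeff g =
        (if g = 1 then algebraMap (ZMod p) (AlgebraicClosure (ZMod p)) i else 0) +
        (if g = 0 then algebraMap (ZMod p) (AlgebraicClosure (ZMod p)) j else 0) := by
    intro i j g
    rw [hcast, hcast, HahnSeries.C_mul_eq_smul, HahnSeries.coeff_add, HahnSeries.coeff_smul, hτ,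
      HahnSeries.C_apply, HahnSeries.coeff_single, HahnSeries.coeff_single]
    split_ifs <;> simp
  have hτp : ∀ i : ZMod p, ZMod.castHom dvd_rfl (HahnF p) i ≠ τ := by
    intro i h
    have h1 := hcoeff 1 (-i) 1
    rw [map_one, one_mul, map_neg, h, ← sub_eq_add_neg, sub_self] at h1
    simp at h1
  have hnz : ∀ i : ZMod p, i ≠ 0 → algebraMap (ZMod p) (AlgebraicClosure (ZMod p)) i ≠ 0 :=
    fun i hi ↦ (map_ne_zero _).2 hi
  obtain ⟨h1, h2, h3, h4⟩ := artinSchreier_pair_primitive (F := KBig p π₀ r) hα hβ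
    (hmem _ hτK) hτp (by
      rintro i j ⟨x, hx⟩
      have hx' : ZMod.castHom dvd_rfl (HahnF p) i * α + ZMod.castHom dvd_rfl (HahnF p) j * β ∈
        KBig p π₀ r := hx ▸ x.2
      rw [hcast, hcast] at hx'
      simpa using KBig_artinSchreier_independent hπ hpd hcd hαsupp hβsupp hx')
  rw [← hθ] at h1 h2 h3 h4
  have hroot := Set.ext_iff.1 h4
  simp only [Set.mem_ofPred_eq] at hroot
  refine ⟨h1, h2, h3, ?_, ?_⟩
  · simpa only [hval] using h4
  · have hord : ∀ i j : ZMod p, HahnSeries.addVal ℝ (AlgebraicClosure (ZMod p))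
        (ZMod.castHom dvd_rfl (HahnF p) i * τ + ZMod.castHom dvd_rfl (HahnF p) j) =
        if j ≠ 0 then ((0 : ℝ) : WithTop ℝ) else if i ≠ 0 then ((1 : ℝ) : WithTop ℝ) else ⊤ := by
      intro i j
      rw [HahnSeries.addVal_apply]
      split_ifs with hj hi
      · refine HahnSeries.orderTop_eq_of_le (g := 0) ?_ ?_
        · rw [HahnSeries.mem_support, hcoeff]
          simpa using hnz j hj
        · intro g hg
          by_contra! hlt
          rw [HahnSeries.mem_support, hcoeff, if_neg (by linarith), if_neg hlt.ne] at hg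
          simp at hg
      · push Not at hj
        refine HahnSeries.orderTop_eq_of_le (g := 1) ?_ ?_
        · rw [HahnSeries.mem_support, hcoeff]
          simpa using hnz i hi
        · intro g hg
          by_contra! hlt
          rw [HahnSeries.mem_support, hcoeff, if_neg hlt.ne, hj] at hg
          simp at hg
      · push Not at hi hj
        simp [hi, hj]
    have hsub : ∀ i j : ZMod p, θ + ZMod.castHom dvd_rfl (HahnF p) i * τ +
        ZMod.castHom dvd_rfl (HahnF p) j - θ = ZMod.castHom dvd_rfl (HahnF p) i * τ +
        ZMod.castHom dvd_rfl (HahnF p) j := fun i j ↦ by ring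
    have hback : ∀ (i j : ZMod p) (γ : ℝ), HahnSeries.addVal ℝ (AlgebraicClosure (ZMod p))
        (ZMod.castHom dvd_rfl (HahnF p) i * τ + ZMod.castHom dvd_rfl (HahnF p) j) = γ →
        ∃ θ' : HahnF p, Polynomial.aeval θ' (minpoly (KBig p π₀ r) θ) = 0 ∧ θ' ≠ θ ∧
          HahnSeries.addVal ℝ (AlgebraicClosure (ZMod p)) (θ' - θ) = γ := by
      intro i j γ h
      refine ⟨_, (hroot _).2 ⟨i, j, rfl⟩, ?_, ?_⟩
      · intro he
        rw [← hsub, he, sub_self, AddValuation.map_zero] at h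
        exact WithTop.top_ne_coe h
      · rw [hsub, h]
    ext γ
    simp only [Set.mem_ofPred_eq, Set.mem_insert_iff, Set.mem_singleton_iff]
    constructor
    · rintro ⟨θ', h, hne, rfl⟩
      obtain ⟨i, j, rfl⟩ := (hroot _).1 h
      rw [hsub, hord]
      by_cases hj : j = 0
      · by_cases hi : i = 0
        · exact absurd (by simp [hi, hj]) hne
        · simp [hi, hj]
      · simp [hj]
    · rintro (rfl | rfl)
      · exact hback 0 1 0 (by rw [hord]; simp)
      · exact hback 1 0 1 (by rw [hord]; simp)
end

section
/- For every prime p there exist a field K of characteristic p, a valuation v on K with value group a subgroup of ℝ, an extension of v to an algebraic closure K̄ of K, and a separable element θ ∈ K̄ with [K(θ):K] = p², such that v(θ' − θ) = 0 for every root θ' ≠ θ of the minimal polynomial of θ over K (so #S_θ = 1), while there exists η ∈ K̄ with [K(η):K] = p and v(θ − η) > v(θ − c) for every c ∈ K (so depth(θ) = 2 > 1 = #S_θ). -/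
/-- The property asserted to hold for some field `K` of characteristic `p`:  there are a
valuation `v` on the algebraic closure of `K` with real values and a separable `θ` of
degree `p²` over `K` such that all differences of distinct conjugates of `θ` have value `0`
(so `#S_θ = 1`), while some `η` of degree `p` over `K` is closer to `θ` than every element
of `K` (so `depth(θ) = 2`). -/
def Statement7Prop (p : ℕ) (K : Type) [Field K] : Prop :=
  CharP K p ∧
  ∃ (v : AddValuation (AlgebraicClosure K) (WithTop ℝ)) (θ : AlgebraicClosure K),
    (minpoly K θ).Separable ∧
    Module.finrank K ↥(IntermediateField.adjoin K {θ}) = p ^ 2 ∧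
    (∀ θ' : AlgebraicClosure K,
      Polynomial.aeval θ' (minpoly K θ) = 0 → θ' ≠ θ → v (θ' - θ) = 0) ∧
    ∃ η : AlgebraicClosure K,
      Module.finrank K ↥(IntermediateField.adjoin K {η}) = p ∧
      ∀ c : K, v (θ - algebraMap K (AlgebraicClosure K) c) < v (θ - η)

open Polynomial in
/-- An Artin-Schreier type polynomial `X ^ q - X - a` is separable when `p ∣ q`. -/
theorem separable_X_pow_sub_X_sub_C {p : ℕ} {K : Type*} [Field K] [CharP K p] {q : ℕ}
    (hq : p ∣ q) (a : K) : (X ^ q - X - C a : K[X]).Separable := by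
  have h : derivative (X ^ q - X - C a : K[X]) = -1 := by
    simp [derivative_X_pow, (CharP.cast_eq_zero_iff K p q).2 hq]
  rw [Polynomial.Separable, h]
  exact isCoprime_one_right.neg_right

open Polynomial in
theorem natDegree_X_pow_sub_X_sub_C {K : Type*} [Field K] {q : ℕ} (hq : 1 < q) (a : K) :
    (X ^ q - X - C a : K[X]).natDegree = q := by
  rw [natDegree_sub_C, natDegree_sub_eq_left_of_natDegree_lt] <;> simp [hq]

/-- The additive valuation `-log ∘ w` attached to a multiplicative real valuation `w`. -/
noncomputable def Valuation.negLog {L : Type*} [Field L] (w : Valuation L NNReal) :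
    AddValuation L (WithTop ℝ) :=
  AddValuation.of (fun x => if w x = 0 then ⊤ else ((-Real.log (w x) : ℝ) : WithTop ℝ))
    (by simp) (by simp)
    (by
      intro x y
      have h := w.map_add x y
      rcases eq_or_ne (w (x + y)) 0 with h0 | h0
      · simp [h0]
      rcases le_max_iff.1 h with h1 | h1
      · have hx : w x ≠ 0 := (lt_of_lt_of_le (pos_iff_ne_zero.2 h0) h1).ne'
        refine min_le_of_left_le ?_
        rw [if_neg hx, if_neg h0, WithTop.coe_le_coe, neg_le_neg_iff]
        exact Real.log_le_log (by exact_mod_cast pos_iff_ne_zero.2 h0) (by exact_mod_cast h1)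
      · have hx : w y ≠ 0 := (lt_of_lt_of_le (pos_iff_ne_zero.2 h0) h1).ne'
        refine min_le_of_right_le ?_
        rw [if_neg hx, if_neg h0, WithTop.coe_le_coe, neg_le_neg_iff]
        exact Real.log_le_log (by exact_mod_cast pos_iff_ne_zero.2 h0) (by exact_mod_cast h1))
    (by
      intro x y
      by_cases hx : w x = 0
      · simp [hx]
      by_cases hy : w y = 0
      · simp [hy]
      have hxy : w (x * y) ≠ 0 := by simp only [map_mul]; exact mul_ne_zero hx hy
      rw [if_neg hx, if_neg hy, if_neg hxy, ← WithTop.coe_add, map_mul, NNReal.coe_mul,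
        Real.log_mul (by exact_mod_cast hx) (by exact_mod_cast hy), neg_add])

theorem Valuation.negLog_apply {L : Type*} [Field L] (w : Valuation L NNReal) (x : L) :
    w.negLog x = if w x = 0 then ⊤ else ((-Real.log (w x) : ℝ) : WithTop ℝ) := rfl

theorem Valuation.negLog_eq_zero {L : Type*} [Field L] {w : Valuation L NNReal} {x : L}
    (hx : w x = 1) : w.negLog x = 0 := by
  simp [negLog_apply, hx]

theorem Valuation.negLog_lt_negLog {L : Type*} [Field L] {w : Valuation L NNReal} {x y : L}
    (h : w y < w x) : w.negLog x < w.negLog y := by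
  have hx : w x ≠ 0 := (bot_le.trans_lt h).ne'
  rw [negLog_apply, negLog_apply, if_neg hx]
  split_ifs with hy
  · exact WithTop.coe_lt_top _
  · rw [WithTop.coe_lt_coe, neg_lt_neg_iff]
    exact Real.log_lt_log (by exact_mod_cast pos_iff_ne_zero.2 hy) (by exact_mod_cast h)

theorem Valuation.pow_eq_of_pow_sub_eq {L : Type*} [Field L] (w : Valuation L NNReal) {q : ℕ}
    (hq : 1 < q) {u T : L} (hT : 1 < w T) (hu : u ^ q - u = T) :
    w u ^ q = w T ∧ 1 < w u := by
  have h1 : 1 < w u := by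
    by_contra! h
    have : w T ≤ 1 := by
      rw [← hu]
      refine (w.map_sub _ _).trans (max_le ?_ h)
      rw [map_pow]
      exact pow_le_one₀ zero_le h
    exact this.not_gt hT
  refine ⟨?_, h1⟩
  rw [← hu, w.map_sub_eq_of_lt_left, map_pow]
  rw [map_pow]
  exact lt_self_pow₀ h1 hq

open Polynomial in
/-- If `w x ^ q = w T` for every conjugate `x` of `u`, then some element of `K` (the norm of `u`
up to sign) has a value whose `q`-th power is `w T ^ [K(u) : K]`. -/
theorem exists_val_pow_eq_pow_natDegree_minpoly {K L : Type*} [Field K] [Field L] [Algebra K L]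
    [IsAlgClosed L] [Algebra.IsIntegral K L] (w : Valuation L NNReal) (u T : L) (q : ℕ)
    (h : ∀ x : L, aeval x (minpoly K u) = 0 → w x ^ q = w T) :
    ∃ c : K, w (algebraMap K L c) ^ q = w T ^ (minpoly K u).natDegree := by
  have hu : IsIntegral K u := Algebra.IsIntegral.isIntegral u
  set g := (minpoly K u).map (algebraMap K L) with hg
  have hsp : g.Splits := IsAlgClosed.splits g
  have hgm : g.Monic := (minpoly.monic hu).map _
  have hcard : g.roots.card = (minpoly K u).natDegree := by
    rw [← hsp.natDegree_eq_card_roots, hg, natDegree_map]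
  have key : ∀ s : Multiset L, (∀ x ∈ s, w x ^ q = w T) → w s.prod ^ q = w T ^ s.card := by
    intro s
    induction s using Multiset.induction_on with
    | empty => simp
    | cons a s ih =>
      intro hs
      rw [Multiset.prod_cons, map_mul, mul_pow, hs a (by simp),
        ih fun x hx => hs x (by simp [hx]), Multiset.card_cons, pow_succ']
  refine ⟨(minpoly K u).coeff 0, ?_⟩
  have h0 : algebraMap K L ((minpoly K u).coeff 0) = (-1) ^ g.natDegree * g.roots.prod := by
    rw [← coeff_map, ← hg, hsp.coeff_zero_eq_prod_roots_of_monic hgm]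
  rw [h0, map_mul, map_pow, Valuation.map_neg, map_one, one_pow, one_mul, key, hcard]
  intro x hx
  refine h x ?_
  rw [mem_roots hgm.ne_zero, hg, IsRoot, eval_map_algebraMap] at hx
  exact hx

open Polynomial IntermediateField in
/-- A field `K` of characteristic `p` satisfies the property if some real valuation on its
algebraic closure has an element `T` of `K` with `1 < w T` such that the value of `T` is no proper
power in the value group of `K`. The witnesses are `θ = u ^ p`, where `u ^ p ^ 2 - u = T`, and the
`p`-th root `η` of `T`. -/
theorem statement7Prop_of_valuation {p : ℕ} (hp : p.Prime) (K : Type) [Field K] [CharP K p]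
    (w : Valuation (AlgebraicClosure K) NNReal) (T : K)
    (hT : 1 < w (algebraMap K _ T))
    (hdvd : ∀ (c : K) (m n : ℕ),
      w (algebraMap K _ c) ^ n = w (algebraMap K _ T) ^ m → n ∣ m) :
    Statement7Prop p K := by
  have : Fact p.Prime := ⟨hp⟩
  have : CharP (AlgebraicClosure K) p := charP_of_injective_algebraMap
    (algebraMap K (AlgebraicClosure K)).injective p
  set L := AlgebraicClosure K
  have hp1 : 1 < p := hp.one_lt
  have hq : 1 < p ^ 2 := Nat.one_lt_pow two_ne_zero hp1
  set t : L := algebraMap K L T with ht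
  obtain ⟨u, hu⟩ : ∃ u : L, u ^ p ^ 2 - u = t := by
    obtain ⟨u, hu⟩ := IsAlgClosed.exists_root (X ^ p ^ 2 - X - C t : L[X]) (by
      refine (natDegree_pos_iff_degree_pos.1 ?_).ne'
      rw [natDegree_X_pow_sub_X_sub_C hq]
      exact zero_lt_one.trans hq)
    exact ⟨u, sub_eq_zero.1 (by simpa using hu)⟩
  obtain ⟨hwu, hwu1⟩ := w.pow_eq_of_pow_sub_eq hq hT hu
  have hup : (u ^ p) ^ p = u + t := by rw [← hu, ← pow_mul, sq]; ring
  have hθ : (u ^ p) ^ p ^ 2 - u ^ p = t ^ p := by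
    rw [← hu, sub_pow_char, ← pow_mul, ← pow_mul, mul_comm]
  have hθ0 : aeval (u ^ p) (X ^ p ^ 2 - X - C (T ^ p) : K[X]) = 0 := by
    simp only [map_sub, map_pow, aeval_X, aeval_C]
    rw [← ht, ← hθ, sub_self]
  have hu0 : aeval u (X ^ p ^ 2 - X - C T : K[X]) = 0 := by
    simp only [map_sub, map_pow, aeval_X, aeval_C]
    rw [← ht, ← hu, sub_self]
  have hadj : K⟮u ^ p⟯ = K⟮u⟯ := by
    apply le_antisymm
    · rw [adjoin_simple_le_iff]
      exact pow_mem (mem_adjoin_simple_self K u) p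
    · rw [adjoin_simple_le_iff]
      have h := sub_mem (pow_mem (mem_adjoin_simple_self K (u ^ p)) p)
        (IntermediateField.algebraMap_mem K⟮u ^ p⟯ T)
      rwa [hup, ← ht, add_sub_cancel_right] at h
  have hint (x : L) : IsIntegral K x := Algebra.IsIntegral.isIntegral x
  have hwθ : w (u ^ p) ^ p = w t := by rw [map_pow, ← pow_mul, ← sq, hwu]
  refine ⟨inferInstance, w.negLog, u ^ p, ?_, ?_, ?_, ?_⟩
  · exact (separable_X_pow_sub_X_sub_C (dvd_pow_self p two_ne_zero) (T ^ p)).of_dvd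
      (minpoly.dvd K _ hθ0)
  · rw [hadj, adjoin.finrank (hint u)]
    obtain ⟨c, hc⟩ := exists_val_pow_eq_pow_natDegree_minpoly (K := K) w u t (p ^ 2) (by
      intro x hx
      refine (w.pow_eq_of_pow_sub_eq hq hT ?_).1
      obtain ⟨r, hr⟩ := minpoly.dvd K u hu0
      have h := congrArg (aeval x) hr
      rw [map_mul, hx, zero_mul] at h
      exact sub_eq_zero.1 (by simpa using h))
    refine le_antisymm ?_ (Nat.le_of_dvd (minpoly.natDegree_pos (hint u)) (hdvd _ _ _ hc))
    have hne : (X ^ p ^ 2 - X - C T : K[X]) ≠ 0 := fun h => by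
      have := natDegree_X_pow_sub_X_sub_C hq T
      rw [h, natDegree_zero] at this
      omega
    exact (natDegree_le_of_dvd (minpoly.dvd K u hu0) hne).trans
      (natDegree_X_pow_sub_X_sub_C hq T).le
  · intro x hx hne
    obtain ⟨r, hr⟩ := minpoly.dvd K _ hθ0
    have h := congrArg (aeval x) hr
    rw [map_mul, hx, zero_mul] at h
    have h : x ^ p ^ 2 - x = t ^ p := sub_eq_zero.1 (by simpa using h)
    have hd : (x - u ^ p) ^ p ^ 2 = x - u ^ p := by
      rw [sub_pow_char_pow]
      linear_combination h - hθ
    have hd0 : x - u ^ p ≠ 0 := sub_ne_zero.2 hne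
    have hd1 : (x - u ^ p) ^ (p ^ 2 - 1) = 1 := by
      apply mul_right_cancel₀ hd0
      rw [← pow_succ, Nat.sub_add_cancel hq.le, hd, one_mul]
    apply Valuation.negLog_eq_zero
    refine (pow_eq_one_iff_of_nonneg zero_le (Nat.sub_pos_of_lt hq).ne').1 ?_
    rw [← map_pow, hd1, map_one]
  · obtain ⟨η, hη⟩ := IsAlgClosed.exists_pow_nat_eq t hp.pos
    refine ⟨η, ?_, fun c => ?_⟩
    · have hirr : Irreducible (X ^ p - C T : K[X]) := by
        refine X_pow_sub_C_irreducible_of_prime hp fun b hb => hp.one_lt.ne' ?_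
        refine Nat.dvd_one.1 (hdvd b 1 p ?_)
        rw [← map_pow, ← map_pow, hb, pow_one]
      rw [adjoin.finrank (hint η), ← minpoly.eq_of_irreducible_of_monic hirr
        (by simp [hη, ← ht]) (monic_X_pow_sub_C T hp.ne_zero), natDegree_X_pow_sub_C]
    · apply Valuation.negLog_lt_negLog
      have h1 : w (u ^ p - η) < w (u ^ p) := by
        refine lt_of_pow_lt_pow_left₀ p zero_le ?_
        rw [← map_pow, sub_pow_char, hη, hup, add_sub_cancel_right, hwθ, ← hwu]
        exact lt_self_pow₀ hwu1 hq
      refine h1.trans_le ?_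
      have hne : w (u ^ p) ≠ w (algebraMap K L c) := fun h => hp.one_lt.ne' <| by
        refine Nat.dvd_one.1 (hdvd c 1 p ?_)
        rw [← h, hwθ, pow_one]
      rw [sub_eq_add_neg, Valuation.map_add_of_distinct_val w (by rwa [Valuation.map_neg])]
      exact le_max_left _ _

open scoped Valued LaurentSeries in
/-- The Laurent series field carries a real valuation, extended to its algebraic closure, whose
order on Laurent series is the order of the `X`-adic valuation. -/
theorem exists_valuation_algebraicClosure_laurentSeries (F : Type*) [Field F] :
    ∃ w : Valuation (AlgebraicClosure F⸨X⸩) NNReal, ∀ x y : F⸨X⸩,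
      w (algebraMap _ _ x) ≤ w (algebraMap _ _ y) ↔
        (Valued.v x : WithZero (Multiplicative ℤ)) ≤ Valued.v y := by
  have hX : (Valued.v (HahnSeries.single (1 : ℤ) (1 : F) : F⸨X⸩) : WithZero (Multiplicative ℤ)) =
      WithZero.exp (-1) := LaurentSeries.valuation_single_zpow F 1
  let _ : (Valued.v : Valuation F⸨X⸩ (WithZero (Multiplicative ℤ))).RankOne :=
    { hom' := (WithZeroMulInt.toNNReal two_ne_zero).comp MonoidWithZeroHom.ValueGroup₀.embedding
      strictMono' := (WithZeroMulInt.toNNReal_strictMono one_lt_two).comp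
        MonoidWithZeroHom.ValueGroup₀.embedding_strictMono
      exists_val_nontrivial := ⟨HahnSeries.single (1 : ℤ) (1 : F), by
        rw [hX]; exact ⟨WithZero.exp_ne_zero, by decide⟩⟩ }
  let _ : NontriviallyNormedField F⸨X⸩ := Valued.toNontriviallyNormedField F⸨X⸩ _
  have : CompleteSpace F⸨X⸩ := LaurentSeries.instLaurentSeriesComplete
  let _ : NormedField (AlgebraicClosure F⸨X⸩) := spectralNorm.normedField F⸨X⸩ _
  have : IsUltrametricDist (AlgebraicClosure F⸨X⸩) :=
    IsUltrametricDist.isUltrametricDist_of_isNonarchimedean_norm isNonarchimedean_spectralNorm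
  refine ⟨NormedField.valuation, fun x y => ?_⟩
  rw [NormedField.valuation_apply, NormedField.valuation_apply, ← NNReal.coe_le_coe]
  change spectralNorm _ _ _ ≤ spectralNorm _ _ _ ↔ _
  rw [spectralNorm_extends, spectralNorm_extends]
  exact Valued.toNormedField.norm_le_iff

/-- For every prime `p` there exist a field `K` of characteristic `p`, a
valuation with value group inside `ℝ` on an algebraic closure of `K`, and a separable `θ`
of degree `p²` over `K` with `#S_θ = 1 < 2 = depth(θ)`. -/
theorem statement7 (p : ℕ) (hp : p.Prime) :
    ∃ (K : Type) (fK : Field K), @Statement7Prop p K fK := by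
  have : Fact p.Prime := ⟨hp⟩
  have : CharP (LaurentSeries (ZMod p)) p := charP_of_injective_algebraMap
    (algebraMap (ZMod p) (LaurentSeries (ZMod p))).injective p
  obtain ⟨w, hw⟩ := exists_valuation_algebraicClosure_laurentSeries (ZMod p)
  have heq (x y : LaurentSeries (ZMod p)) (h : w (algebraMap _ _ x) = w (algebraMap _ _ y)) :
      (Valued.v x : WithZero (Multiplicative ℤ)) = Valued.v y :=
    le_antisymm ((hw x y).1 h.le) ((hw y x).1 h.ge)
  have hT : (Valued.v (HahnSeries.single (-1 : ℤ) (1 : ZMod p) : LaurentSeries (ZMod p)) :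
      WithZero (Multiplicative ℤ)) = WithZero.exp 1 :=
    LaurentSeries.valuation_single_zpow (ZMod p) (-1)
  refine ⟨LaurentSeries (ZMod p), inferInstance, statement7Prop_of_valuation hp _ w
    (HahnSeries.single (-1 : ℤ) (1 : ZMod p)) ?_ fun c m n h => ?_⟩
  · rw [← w.map_one, ← map_one (algebraMap (LaurentSeries (ZMod p)) _), ← not_le, hw, hT, map_one]
    decide
  · rw [← map_pow, ← map_pow, ← map_pow, ← map_pow] at h
    have h := heq _ _ h
    rw [map_pow, map_pow, hT] at h
    have := congrArg WithZero.log h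
    simp only [WithZero.log_pow, WithZero.log_exp, nsmul_eq_mul, mul_one] at this
    exact Int.natCast_dvd_natCast.1 ⟨_, this.symm⟩
end

section
/- For every prime p there exist a field K of characteristic p, a valuation v on K with value group a subgroup of ℝ, an extension of v to an algebraic closure K̄ of K, and a separable element θ ∈ K̄ with [K(θ):K] = p², such that the set {v(θ' − θ) : θ' a root of the minimal polynomial of θ over K, θ' ≠ θ} has exactly two elements, while for every ε ∈ K̄ with [K(ε):K] < p² there exists c ∈ K with v(θ − c) ≥ v(θ − ε). (Hence θ is pure, i.e. depth(θ) = 1, but #S_θ = 2; this answers Kuhlmann's question negatively.) -/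
/-- The property asserted to hold for some field `K` of characteristic `p`:  there are a
valuation `v` on the algebraic closure of `K` with real values and a separable `θ` of
degree `p²` over `K` such that the set of values `v(θ' - θ)`, for `θ' ≠ θ` a conjugate of
`θ`, has exactly two elements, while `θ` is pure: every `ε` of degree `< p²` over `K`
admits `c ∈ K` with `v(θ - c) ≥ v(θ - ε)`. -/
def Statement8Prop (p : ℕ) (K : Type) [Field K] : Prop :=
  CharP K p ∧
  ∃ (v : AddValuation (AlgebraicClosure K) (WithTop ℝ)) (θ : AlgebraicClosure K),
    (minpoly K θ).Separable ∧
    Module.finrank K ↥(IntermediateField.adjoin K {θ}) = p ^ 2 ∧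
    (∃ γ₁ γ₂ : WithTop ℝ, γ₁ ≠ γ₂ ∧
      {γ : WithTop ℝ | ∃ θ' : AlgebraicClosure K,
        Polynomial.aeval θ' (minpoly K θ) = 0 ∧ θ' ≠ θ ∧ v (θ' - θ) = γ} = {γ₁, γ₂}) ∧
    ∀ ε : AlgebraicClosure K,
      Module.finrank K ↥(IntermediateField.adjoin K {ε}) < p ^ 2 →
      ∃ c : K, v (θ - ε) ≤ v (θ - algebraMap K (AlgebraicClosure K) c)

open Polynomial

/-- If `v t = 1` and `w ^ p - t * w` has small valuation, then `w ^ p` is the dominant term. -/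
theorem AddValuation.map_eq_div_of_map_pow_sub_mul {L : Type*} [Field L]
    (v : AddValuation L (WithTop ℝ)) {p : ℕ} (hp : 1 < p) {t w : L} {s : ℝ}
    (ht : v t = (1 : ℝ)) (hs : (p - 1) * s < p) (h : v (w ^ p - t * w) = s) :
    v w = (s / p : ℝ) := by
  have hp' : (1 : ℝ) < p := by exact_mod_cast hp
  have hw : w ≠ 0 := by
    rintro rfl
    simp [show p ≠ 0 by omega] at h
  obtain ⟨r, hr⟩ := WithTop.ne_top_iff_exists.mp (v.ne_top_iff.mpr hw)
  have h₁ : v (w ^ p) = (p * r : ℝ) := by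
    rw [v.map_pow, ← hr, ← WithTop.coe_nsmul, nsmul_eq_mul]
  have h₂ : v (t * w) = (1 + r : ℝ) := by
    rw [v.map_mul, ht, ← hr, ← WithTop.coe_add]
  rw [← hr]
  congr 1
  rcases lt_trichotomy (p * r) (1 + r) with hlt | heq | hgt
  · rw [v.map_sub_eq_of_lt_left (by rw [h₁, h₂]; exact_mod_cast hlt), h₁] at h
    have : p * r = s := by exact_mod_cast h
    field_simp
    linarith
  · have := v.map_sub (w ^ p) (t * w)
    rw [h, h₁, h₂, heq, min_self] at this
    have : 1 + r ≤ s := by exact_mod_cast this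
    nlinarith
  · rw [v.map_sub_eq_of_lt_right (by rw [h₁, h₂]; exact_mod_cast hgt), h₂] at h
    have : 1 + r = s := by exact_mod_cast h
    nlinarith

theorem AddValuation.map_eq_inv_of_pow_sub_mul_eq_zero {L : Type*} [Field L]
    (v : AddValuation L (WithTop ℝ)) {p : ℕ} (hp : 1 < p) {t w : L}
    (ht : v t = (1 : ℝ)) (hw : w ≠ 0) (h : w ^ p - t * w = 0) :
    v w = ((p - 1 : ℝ)⁻¹ : ℝ) := by
  have hp' : (1 : ℝ) < p := by exact_mod_cast hp
  obtain ⟨r, hr⟩ := WithTop.ne_top_iff_exists.mp (v.ne_top_iff.mpr hw)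
  have h₁ := congrArg v (sub_eq_zero.mp h)
  rw [v.map_pow, v.map_mul, ht, ← hr, ← WithTop.coe_nsmul, nsmul_eq_mul, ← WithTop.coe_add] at h₁
  have h₂ : p * r = 1 + r := by exact_mod_cast h₁
  rw [← hr]
  congr 1
  refine eq_inv_of_mul_eq_one_left ?_
  linarith

/-- If `v` is integral on `K` and `v ε = 1 / N`, then `ε` is not a root of a nonzero polynomial of
degree less than `N` over `K`. -/
theorem AddValuation.le_natDegree_of_aeval_eq_zero {K L : Type*} [Field K] [Field L] [Algebra K L]
    (v : AddValuation L (WithTop ℝ)) (hK : ∀ x : K, x ≠ 0 → ∃ n : ℤ, v (algebraMap K L x) = (n : ℝ))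
    {N : ℕ} {ε : L} (hε : v ε = ((N : ℝ)⁻¹ : ℝ)) {q : K[X]} (hq : q ≠ 0) (h : aeval ε q = 0) :
    N ≤ q.natDegree := by
  classical
  by_contra! hN
  have hN0 : (N : ℝ) ≠ 0 := by
    have : 0 < N := by omega
    positivity
  set f : ℕ → L := fun i ↦ algebraMap K L (q.coeff i) * ε ^ i with hf
  have hval : ∀ i ∈ q.support, ∃ n : ℤ, v (f i) = ((n + i * (N : ℝ)⁻¹ : ℝ)) := fun i hi ↦ by
    obtain ⟨n, hn⟩ := hK _ (mem_support_iff.mp hi)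
    exact ⟨n, by simp only [hf]; rw [v.map_mul, hn, v.map_pow, hε, ← WithTop.coe_nsmul,
      nsmul_eq_mul, ← WithTop.coe_add]⟩
  have hinj : ∀ i ∈ q.support, ∀ j ∈ q.support, v (f i) = v (f j) → i = j := by
    intro i hi j hj hij
    obtain ⟨n, hn⟩ := hval i hi
    obtain ⟨m, hm⟩ := hval j hj
    rw [hn, hm] at hij
    have h₁ : (n + i * (N : ℝ)⁻¹ : ℝ) = m + j * (N : ℝ)⁻¹ := by exact_mod_cast hij
    field_simp at h₁
    have h₂ : N * n + i = N * m + j := by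
      rw [mul_comm (N : ℤ) n]
      exact_mod_cast h₁
    have hiN : i < N := (le_natDegree_of_mem_supp i hi).trans_lt hN
    have hjN : j < N := (le_natDegree_of_mem_supp j hj).trans_lt hN
    have h₃ := congrArg (· % (N : ℤ)) h₂
    simp only [Int.mul_add_emod_self_left] at h₃
    rw [Int.emod_eq_of_lt (by omega) (by omega), Int.emod_eq_of_lt (by omega) (by omega)] at h₃
    exact_mod_cast h₃
  obtain ⟨j, hj, hmin⟩ := q.support.exists_min_image (fun i ↦ v (f i)) (nonempty_support_iff.mpr hq)
  have hjtop : v (f j) ≠ ⊤ := by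
    obtain ⟨n, hn⟩ := hval j hj
    rw [hn]
    exact WithTop.coe_ne_top
  have hsum : f j + ∑ i ∈ q.support.erase j, f i = 0 := by
    rw [Finset.add_sum_erase _ _ hj, ← h, aeval_eq_sum_range, ← Finset.sum_subset
      (s₁ := q.support) (fun i hi ↦ Finset.mem_range_succ_iff.mpr (le_natDegree_of_mem_supp i hi))]
    · simp [hf, Algebra.smul_def]
    · intro i _ hi
      simp [notMem_support_iff.mp hi]
  have hlt := v.map_lt_sum hjtop (s := q.support.erase j) (f := f) fun i hi ↦
    lt_of_le_of_ne (hmin i (Finset.mem_of_mem_erase hi)) fun hij ↦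
      Finset.ne_of_mem_erase hi (hinj j hj i (Finset.mem_of_mem_erase hi) hij).symm
  rw [← neg_eq_of_add_eq_zero_right hsum, v.map_neg] at hlt
  exact hlt.false

theorem IsAlgClosed.exists_pow_sub_mul_eq {L : Type*} [Field L] [IsAlgClosed L] {p : ℕ}
    (hp : 1 < p) (t y : L) : ∃ w : L, w ^ p - t * w = y := by
  have hdeg : (X ^ p - (C t * X + C y)).natDegree = p := by
    rw [natDegree_sub_eq_left_of_natDegree_lt, natDegree_X_pow]
    rw [natDegree_X_pow]
    exact natDegree_linear_le.trans_lt hp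
  obtain ⟨w, hw⟩ := IsAlgClosed.exists_root (X ^ p - (C t * X + C y))
    (fun h ↦ by rw [natDegree_eq_of_degree_eq_some (n := 0) h] at hdeg; omega)
  refine ⟨w, ?_⟩
  simp only [IsRoot.def, eval_sub, eval_pow, eval_X, eval_add, eval_mul, eval_C] at hw
  linear_combination hw

/-- A nonzero `w` with `w ^ p = t * w`. -/
theorem IsAlgClosed.exists_ne_zero_pow_sub_mul_eq_zero {L : Type*} [Field L] [IsAlgClosed L]
    {p : ℕ} (hp : 1 < p) {t : L} (ht : t ≠ 0) : ∃ w : L, w ≠ 0 ∧ w ^ p - t * w = 0 := by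
  obtain ⟨w, hw⟩ := IsAlgClosed.exists_pow_nat_eq t (n := p - 1) (by omega)
  refine ⟨w, fun h ↦ ht ?_, ?_⟩
  · rw [← hw, h, zero_pow (by omega)]
  · rw [← hw, ← pow_succ, Nat.sub_add_cancel hp.le, sub_self]

/-- Over a field with an integral valuation and a uniformizer `t`, a root of
`(X ^ p - t X) ^ p - t (X ^ p - t X) - t` is pure of degree `p ^ 2`, and its differences with its
conjugates have exactly two valuations. -/
theorem statement8Prop_of_addValuation {p : ℕ} (hp : p.Prime) {K : Type} [Field K] [CharP K p]
    (v : AddValuation (AlgebraicClosure K) (WithTop ℝ)) (t : K)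
    (ht : v (algebraMap K (AlgebraicClosure K) t) = (1 : ℝ))
    (hK : ∀ x : K, x ≠ 0 → ∃ n : ℤ, v (algebraMap K (AlgebraicClosure K) x) = (n : ℝ)) :
    Statement8Prop p K := by
  have : Fact p.Prime := ⟨hp⟩
  have hp1 := hp.one_lt
  have hpR : (1 : ℝ) < p := by exact_mod_cast hp1
  have : CharP (AlgebraicClosure K) p :=
    charP_of_injective_algebraMap (algebraMap K (AlgebraicClosure K)).injective p
  set T := algebraMap K (AlgebraicClosure K) t with hT
  have ht0 : t ≠ 0 := by
    rintro rfl
    simp [hT] at ht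
  have hT0 : T ≠ 0 := by simpa [hT] using ht0
  obtain ⟨u, hu⟩ := IsAlgClosed.exists_pow_sub_mul_eq hp1 T T
  obtain ⟨θ, hθ⟩ := IsAlgClosed.exists_pow_sub_mul_eq hp1 T u
  have hvu : v u = (1 / p : ℝ) :=
    v.map_eq_div_of_map_pow_sub_mul hp1 ht (by linarith) (by rw [hu, ht])
  have hvθ : v θ = (((p ^ 2 : ℕ) : ℝ)⁻¹ : ℝ) := by
    rw [v.map_eq_div_of_map_pow_sub_mul hp1 ht (s := 1 / p) _ (by rw [hθ, hvu])]
    · congr 1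
      push_cast
      field_simp
    · rw [mul_one_div, div_lt_iff₀ (by linarith)]
      nlinarith
  set h : K[X] := X ^ p - C t * X with hh
  set g : K[X] := X ^ p - (C t * X + C t) with hg
  have hlin : (C t * X + C t : K[X]).degree < p :=
    degree_linear_le.trans_lt (by exact_mod_cast hp1)
  have hlin' : (C t * X : K[X]).degree < p :=
    (degree_C_mul_X_le t).trans_lt (by exact_mod_cast hp1)
  have hhm : h.Monic := monic_X_pow_sub hlin'
  have hgm : g.Monic := monic_X_pow_sub hlin
  have hhd : h.natDegree = p := natDegree_eq_of_degree_eq_some <| by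
    rw [hh, degree_sub_eq_left_of_degree_lt (by rwa [degree_X_pow]), degree_X_pow]
  have hgd : g.natDegree = p := natDegree_eq_of_degree_eq_some <| by
    rw [hg, degree_sub_eq_left_of_degree_lt (by rwa [degree_X_pow]), degree_X_pow]
  have hfm : (g.comp h).Monic := hgm.comp hhm (by rw [hhd]; omega)
  have hfd : (g.comp h).natDegree = p ^ 2 := by rw [natDegree_comp, hhd, hgd, sq]
  have haeval (x : AlgebraicClosure K) :
      aeval x (g.comp h) = (x ^ p - T * x) ^ p - T * (x ^ p - T * x) - T := by
    simp [hg, hh, hT]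
    ring
  have hfθ : aeval θ (g.comp h) = 0 := by rw [haeval, hθ, hu, sub_self]
  have hfsep : (g.comp h).Separable := by
    have hder : derivative (g.comp h) = C (t ^ 2) := by
      simp [hg, hh, derivative_pow, sq]
    rw [separable_def, hder]
    exact isCoprime_one_right.of_isCoprime_of_dvd_right
      ((isUnit_C.mpr (pow_ne_zero 2 ht0).isUnit).dvd)
  have hint (x : AlgebraicClosure K) : IsIntegral K x := Algebra.IsIntegral.isIntegral x
  have hdeg (ε : AlgebraicClosure K) (hε : v ε = v θ) : p ^ 2 ≤ (minpoly K ε).natDegree :=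
    v.le_natDegree_of_aeval_eq_zero hK (hε.trans hvθ) (minpoly.ne_zero (hint ε)) (minpoly.aeval K ε)
  have hmin : minpoly K θ = g.comp h :=
    (eq_of_monic_of_dvd_of_natDegree_le (minpoly.monic (hint θ)) hfm (minpoly.dvd K θ hfθ)
      (hfd.trans_le (hdeg θ rfl))).symm
  have hconj (x : AlgebraicClosure K) : aeval x (minpoly K θ) = 0 ↔
      ((x - θ) ^ p - T * (x - θ)) ^ p - T * ((x - θ) ^ p - T * (x - θ)) = 0 := by
    have key : aeval x (g.comp h) - aeval θ (g.comp h) =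
        ((x - θ) ^ p - T * (x - θ)) ^ p - T * ((x - θ) ^ p - T * (x - θ)) := by
      rw [haeval, haeval, sub_pow_char x θ, show x ^ p - θ ^ p - T * (x - θ) =
        (x ^ p - T * x) - (θ ^ p - T * θ) by ring, sub_pow_char (x ^ p - T * x)]
      ring
    rw [hmin, ← key, hfθ, sub_zero]
  have hval (z y : AlgebraicClosure K) (hy : y ≠ 0) (hyT : y ^ p - T * y = 0)
      (hzy : z ^ p - T * z = y) : v z = ((p - 1 : ℝ)⁻¹ / p : ℝ) :=
    v.map_eq_div_of_map_pow_sub_mul hp1 ht (by rw [mul_inv_cancel₀ (by linarith)]; exact hpR)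
      (by rw [hzy, v.map_eq_inv_of_pow_sub_mul_eq_zero hp1 ht hy hyT])
  refine ⟨inferInstance, v, θ, hmin ▸ hfsep, ?_,
    ⟨((p - 1 : ℝ)⁻¹ : ℝ), ((p - 1 : ℝ)⁻¹ / p : ℝ), ?_, ?_⟩, ?_⟩
  · rw [IntermediateField.adjoin.finrank (hint θ), hmin, hfd]
  · intro heq
    have h₁ : (p - 1 : ℝ)⁻¹ = (p - 1 : ℝ)⁻¹ / p := by exact_mod_cast heq
    have h₂ : (0 : ℝ) < (p - 1 : ℝ)⁻¹ := inv_pos.mpr (by linarith)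
    exact (div_lt_self h₂ hpR).ne' h₁
  · ext γ
    simp only [Set.mem_ofPred_eq, Set.mem_insert_iff, Set.mem_singleton_iff]
    constructor
    · rintro ⟨x, hx, hne, rfl⟩
      rw [hconj] at hx
      by_cases hy : (x - θ) ^ p - T * (x - θ) = 0
      · exact .inl (v.map_eq_inv_of_pow_sub_mul_eq_zero hp1 ht (sub_ne_zero.mpr hne) hy)
      · exact .inr (hval _ _ hy hx rfl)
    · obtain ⟨y, hy, hyT⟩ := IsAlgClosed.exists_ne_zero_pow_sub_mul_eq_zero hp1 hT0
      rintro (rfl | rfl)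
      · refine ⟨y + θ, ?_, by simpa using hy, ?_⟩
        · rw [hconj, add_sub_cancel_right, hyT, zero_pow hp.ne_zero, mul_zero, sub_zero]
        · rw [add_sub_cancel_right, v.map_eq_inv_of_pow_sub_mul_eq_zero hp1 ht hy hyT]
      · obtain ⟨z, hz⟩ := IsAlgClosed.exists_pow_sub_mul_eq hp1 T y
        have hz0 : z ≠ 0 := by
          rintro rfl
          simp [hp.ne_zero] at hz
          exact hy hz.symm
        refine ⟨z + θ, ?_, by simpa using hz0, ?_⟩
        · rw [hconj, add_sub_cancel_right, hz, hyT]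
        · rw [add_sub_cancel_right, hval z y hy hyT hz]
  · intro ε hε
    refine ⟨0, ?_⟩
    rw [map_zero, sub_zero]
    by_contra! hlt
    rw [IntermediateField.adjoin.finrank (hint ε)] at hε
    rw [v.map_sub_swap] at hlt
    exact hε.not_ge (hdeg ε (v.map_eq_of_lt_sub hlt))

open Classical in
/-- The additive valuation `x ↦ log ‖x‖ / log c` of a nonarchimedean norm, for `0 < c < 1`. -/
noncomputable def addValuationOfNorm (L : Type*) [NormedField L] [IsUltrametricDist L] {c : ℝ}
    (hc0 : 0 < c) (hc1 : c < 1) : AddValuation L (WithTop ℝ) :=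
  AddValuation.of (fun x ↦ if x = 0 then ⊤ else ((Real.logb c ‖x‖ : ℝ) : WithTop ℝ)) (by simp)
    (by simp)
    (by
      intro x y
      by_cases hx : x = 0
      · simp [hx]
      by_cases hy : y = 0
      · simp [hy]
      by_cases hxy : x + y = 0
      · simp [hxy]
      simp only [hx, hy, hxy, if_false]
      rw [← WithTop.coe_min, WithTop.coe_le_coe, min_le_iff]
      refine (le_max_iff.mp (IsUltrametricDist.norm_add_le_max x y)).imp ?_ ?_ <;> intro hle <;>
        rwa [Real.logb_le_logb_of_base_lt_one hc0 hc1 (by positivity) (by positivity)])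
    (by
      intro x y
      by_cases hx : x = 0
      · simp [hx]
      by_cases hy : y = 0
      · simp [hy]
      simp only [hx, hy, mul_eq_zero, or_self, if_false]
      rw [norm_mul, Real.logb_mul (by positivity) (by positivity), WithTop.coe_add])

theorem addValuationOfNorm_apply {L : Type*} [NormedField L] [IsUltrametricDist L] {c : ℝ}
    (hc0 : 0 < c) (hc1 : c < 1) {x : L} (hx : x ≠ 0) :
    addValuationOfNorm L hc0 hc1 x = (Real.logb c ‖x‖ : ℝ) := by
  simp [addValuationOfNorm, hx]

theorem statement8Prop_of_complete {p : ℕ} (hp : p.Prime) {K : Type} [NontriviallyNormedField K]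
    [IsUltrametricDist K] [CompleteSpace K] [CharP K p] (t : K) (ht0 : t ≠ 0) (ht1 : ‖t‖ < 1)
    (hK : ∀ x : K, x ≠ 0 → ∃ n : ℤ, ‖x‖ = ‖t‖ ^ n) : Statement8Prop p K := by
  let : NormedField (AlgebraicClosure K) := spectralNorm.normedField K (AlgebraicClosure K)
  have : IsUltrametricDist (AlgebraicClosure K) :=
    IsUltrametricDist.isUltrametricDist_of_isNonarchimedean_norm isNonarchimedean_spectralNorm
  have hnorm (x : K) : ‖algebraMap K (AlgebraicClosure K) x‖ = ‖x‖ := spectralNorm_extends x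
  have ht : 0 < ‖t‖ := norm_pos_iff.mpr ht0
  have hval (x : K) (hx : x ≠ 0) (n : ℤ) (hn : ‖x‖ = ‖t‖ ^ n) :
      addValuationOfNorm (AlgebraicClosure K) ht ht1 (algebraMap K _ x) = (n : ℝ) := by
    rw [addValuationOfNorm_apply _ _ (by simpa using hx), hnorm, hn, Real.logb, Real.log_zpow,
      mul_div_cancel_right₀ _ (Real.log_neg ht ht1).ne]
  refine statement8Prop_of_addValuation hp (addValuationOfNorm (AlgebraicClosure K) ht ht1) t ?_ ?_
  · simpa using hval t ht0 1 (by simp)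
  · intro x hx
    obtain ⟨n, hn⟩ := hK x hx
    exact ⟨n, hval x hx n hn⟩

open scoped LaurentSeries Valued in
theorem statement8Prop_laurentSeries {p : ℕ} (hp : p.Prime) :
    haveI : Fact p.Prime := ⟨hp⟩
    Statement8Prop p (ZMod p)⸨X⸩ := by
  have : Fact p.Prime := ⟨hp⟩
  have hv (n : ℤ) : Valued.v (HahnSeries.single n (1 : ZMod p) : (ZMod p)⸨X⸩) =
      WithZero.exp (-n) := LaurentSeries.valuation_single_zpow _ n
  let : (Valued.v (R := (ZMod p)⸨X⸩)).RankOne :=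
    { hom' := (WithZeroMulInt.toNNReal (two_ne_zero (α := NNReal))).comp
        MonoidWithZeroHom.ValueGroup₀.embedding
      strictMono' := (WithZeroMulInt.toNNReal_strictMono one_lt_two).comp
        MonoidWithZeroHom.ValueGroup₀.embedding_strictMono
      exists_val_nontrivial := ⟨HahnSeries.single (1 : ℤ) 1, by rw [hv]; decide⟩ }
  have : CharP (ZMod p)⸨X⸩ p :=
    charP_of_injective_algebraMap (algebraMap (ZMod p) (ZMod p)⸨X⸩).injective p
  have ht0 : (HahnSeries.single (1 : ℤ) (1 : ZMod p) : (ZMod p)⸨X⸩) ≠ 0 := by simp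
  refine statement8Prop_of_complete hp (HahnSeries.single (1 : ℤ) (1 : ZMod p)) ht0 ?_ ?_
  · rw [Valued.toNormedField.norm_lt_one_iff, hv]
    decide
  · intro x hx
    refine ⟨-WithZero.log (Valued.v x), ?_⟩
    have hvx : Valued.v x = Valued.v
        ((HahnSeries.single (1 : ℤ) (1 : ZMod p) : (ZMod p)⸨X⸩) ^ (-WithZero.log (Valued.v x))) := by
      rw [map_zpow₀, hv, ← WithZero.exp_zsmul]
      simp [WithZero.exp_log, hx]
    rw [← norm_zpow]
    exact le_antisymm (Valued.toNormedField.norm_le_iff.mpr hvx.le)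
      (Valued.toNormedField.norm_le_iff.mpr hvx.ge)

/-- For every prime `p` there exist a field `K` of characteristic `p`, a
valuation with value group inside `ℝ` on an algebraic closure of `K`, and a separable `θ`
of degree `p²` over `K` which is pure (`depth(θ) = 1`) but has `#S_θ = 2`;  this answers
Kuhlmann's question negatively. -/
theorem statement8 (p : ℕ) (hp : p.Prime) :
    ∃ (K : Type) (fK : Field K), @Statement8Prop p K fK := by
  have : Fact p.Prime := ⟨hp⟩
  exact ⟨_, _, statement8Prop_laurentSeries hp⟩
end

section
/- For every prime p there exist a field K of characteristic p, a valuation v on K with value group a subgroup of ℝ, an extension of v to an algebraic closure K̄ of K, and an element β ∈ K̄ with β^p − β ∈ K and β ∉ K, such that the extension (K(β)/K, v) is immediate, every root β' ≠ β of the minimal polynomial of β over K satisfies v(β' − β) = 0, and v(β − c) < −1 for every c ∈ K. (Hence the main invariant satisfies δ(β) ≤ (−1)⁻ < 0⁻ = ω(β)⁻, giving a negative answer to Question 3 for immediate extensions.) -/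
/-- The property asserted to hold for some field `K` of characteristic `p`:  there are a
valuation `v` on the algebraic closure of `K` with real values and an Artin–Schreier
element `β` over `K` such that `(K(β)/K, v)` is immediate, all differences of distinct
conjugates of `β` have value `0`, and `v(β - c) < -1` for every `c ∈ K`. -/
def Statement9Prop (p : ℕ) (K : Type) [Field K] : Prop :=
  CharP K p ∧
  ∃ (v : AddValuation (AlgebraicClosure K) (WithTop ℝ)) (β : AlgebraicClosure K),
    β ∉ Set.range (algebraMap K (AlgebraicClosure K)) ∧
    β ^ p - β ∈ Set.range (algebraMap K (AlgebraicClosure K)) ∧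
    -- the extension (K(β)/K, v) is immediate:
    ({γ : WithTop ℝ | ∃ x ∈ IntermediateField.adjoin K {β}, x ≠ 0 ∧ v x = γ} =
      {γ : WithTop ℝ | ∃ c : K, c ≠ 0 ∧ v (algebraMap K (AlgebraicClosure K) c) = γ}) ∧
    (∀ x ∈ IntermediateField.adjoin K {β}, 0 ≤ v x →
      ∃ c : K, 0 < v (x - algebraMap K (AlgebraicClosure K) c)) ∧
    -- every conjugate β' ≠ β satisfies v(β' - β) = 0:
    (∀ β' : AlgebraicClosure K,
      Polynomial.aeval β' (minpoly K β) = 0 → β' ≠ β → v (β' - β) = 0) ∧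
    -- v(β - c) < -1 for every c ∈ K:
    ∀ c : K, v (β - algebraMap K (AlgebraicClosure K) c) < ((-1 : ℝ) : WithTop ℝ)


/-- The exponential `r ↦ exp (-r)`, sending `⊤` to `0`. -/
noncomputable def expNegTop (a : WithTop ℝ) : ℝ := a.recTopCoe 0 fun r => Real.exp (-r)

@[simp] lemma expNegTop_top : expNegTop ⊤ = 0 := rfl

@[simp] lemma expNegTop_coe (r : ℝ) : expNegTop r = Real.exp (-r) := rfl

lemma expNegTop_nonneg (a : WithTop ℝ) : 0 ≤ expNegTop a := by
  induction a using WithTop.recTopCoe <;> simp [Real.exp_nonneg]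

lemma expNegTop_eq_zero {a : WithTop ℝ} : expNegTop a = 0 ↔ a = ⊤ := by
  induction a using WithTop.recTopCoe <;> simp [Real.exp_ne_zero]

lemma expNegTop_add (a b : WithTop ℝ) : expNegTop (a + b) = expNegTop a * expNegTop b := by
  induction a using WithTop.recTopCoe
  · simp
  induction b using WithTop.recTopCoe
  · simp
  rw [← WithTop.coe_add, expNegTop_coe, expNegTop_coe, expNegTop_coe, ← Real.exp_add, neg_add]

lemma expNegTop_strictAnti : StrictAnti expNegTop := by
  intro a b h
  lift a to ℝ using h.ne_top
  induction b using WithTop.recTopCoe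
  · simp [Real.exp_pos]
  · simpa using h

/-- The absolute value `exp (-v)` attached to a real-valued additive valuation `v`. -/
noncomputable def AddValuation.expAbs {F : Type*} [Field F] (v : AddValuation F (WithTop ℝ)) :
    AbsoluteValue F ℝ where
  toFun x := expNegTop (v x)
  map_mul' x y := by simp [AddValuation.map_mul, expNegTop_add]
  nonneg' x := expNegTop_nonneg _
  eq_zero' x := by simp [expNegTop_eq_zero, AddValuation.top_iff]
  add_le' x y := by
    have h := expNegTop_strictAnti.antitone (v.map_add x y)
    rw [expNegTop_strictAnti.antitone.map_min] at h
    exact h.trans (max_le_add_of_nonneg (expNegTop_nonneg _) (expNegTop_nonneg _))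

/-- A nonarchimedean multiplicative norm is of the form `exp (-w)` for an additive valuation `w`. -/
lemma exists_addValuation_of_mulAlgebraNorm {E Ω : Type*} [NormedField E] [Field Ω] [Algebra E Ω]
    (N : MulAlgebraNorm E Ω) (hN : IsNonarchimedean N) :
    ∃ w : AddValuation Ω (WithTop ℝ), ∀ x, expNegTop (w x) = N x := by
  have hsurj : ∀ r : ℝ, 0 ≤ r → ∃ a, expNegTop a = r := fun r hr => by
    rcases hr.eq_or_lt with rfl | hr
    · exact ⟨⊤, rfl⟩
    · exact ⟨((-Real.log r : ℝ) : WithTop ℝ), by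
        rw [expNegTop_coe, neg_neg, Real.exp_log hr]⟩
  choose f hf using fun x => hsurj (N x) (apply_nonneg N x)
  have hinj := expNegTop_strictAnti.injective
  refine ⟨AddValuation.of f (hinj ?_) (hinj ?_) (fun x y => ?_) (fun x y => hinj ?_), hf⟩
  · simp [hf]
  · rw [hf, map_one N, ← WithTop.coe_zero, expNegTop_coe]; simp
  · rw [← expNegTop_strictAnti.le_iff_ge, expNegTop_strictAnti.antitone.map_min, hf, hf, hf]
    exact hN x y
  · rw [expNegTop_add, hf, hf, hf, map_mul]

/-- A nontrivial real valuation on a field extends to an algebraically closed overfield. -/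
lemma AddValuation.exists_extension_isAlgClosed {F : Type} [Field F]
    (v : AddValuation F (WithTop ℝ)) {t : F} (ht : v t < 0) :
    ∃ (Ω : Type) (_ : Field Ω) (_ : IsAlgClosed Ω) (j : F →+* Ω)
      (w : AddValuation Ω (WithTop ℝ)), ∀ x, w (j x) = v x := by
  let E := v.expAbs.Completion
  have hnorm : ∀ x : F, ‖((WithAbs.toAbs v.expAbs x : WithAbs v.expAbs) : E)‖ = expNegTop (v x) :=
    fun x => UniformSpace.Completion.norm_coe _
  have hE : IsUltrametricDist E := by
    refine IsUltrametricDist.isUltrametricDist_of_forall_norm_add_le_max_norm fun x y => ?_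
    refine UniformSpace.Completion.induction_on₂ x y ?_ fun a b => ?_
    · exact isClosed_le (by fun_prop) (by fun_prop)
    · have h := expNegTop_strictAnti.antitone (v.map_add a.ofAbs b.ofAbs)
      rw [expNegTop_strictAnti.antitone.map_min] at h
      rw [← UniformSpace.Completion.coe_add, UniformSpace.Completion.norm_coe,
        UniformSpace.Completion.norm_coe, UniformSpace.Completion.norm_coe]
      exact h
  let : NontriviallyNormedField E :=
    { (inferInstance : NormedField E) with
      non_trivial := ⟨(WithAbs.toAbs v.expAbs t : WithAbs v.expAbs), by
        rw [hnorm]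
        have := expNegTop_strictAnti ht
        rw [← WithTop.coe_zero, expNegTop_coe] at this
        simpa using this⟩ }
  let Ω := AlgebraicClosure E
  obtain ⟨w, hw⟩ := exists_addValuation_of_mulAlgebraNorm (spectralMulAlgNorm E Ω)
    (isNonarchimedean_spectralNorm (K := E) (L := Ω))
  refine ⟨Ω, inferInstance, inferInstance,
    (algebraMap E Ω).comp (UniformSpace.Completion.coeRingHom.comp
      (WithAbs.equiv v.expAbs).symm.toRingHom), w, fun x => expNegTop_strictAnti.injective ?_⟩
  rw [hw, ← hnorm]
  exact spectralNorm_extends _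

/-- There is a strictly increasing sequence of reals below `-1` which is linearly independent
over `ℚ`, as witnessed by a dual family. -/
lemma exists_strictMono_lt_neg_one_dual :
    ∃ (γ : ℕ → ℝ) (φ : ℕ → Module.Dual ℚ ℝ), StrictMono γ ∧ (∀ i, γ i < -1) ∧
      ∀ i j, φ i (γ j) = if i = j then 1 else 0 := by
  let b := Module.Basis.ofVectorSpace ℚ ℝ
  have : Infinite (Module.Basis.ofVectorSpaceIndex ℚ ℝ) := by
    rw [Cardinal.infinite_iff, b.mk_eq_rank'', Real.rank_rat_real]
    exact Cardinal.aleph0_le_continuum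
  let e := Infinite.natEmbedding (Module.Basis.ofVectorSpaceIndex ℚ ℝ)
  have hscale : ∀ n : ℕ, ∃ q : ℚ, q ≠ 0 ∧
      -1 - 1 / ((n : ℝ) + 1) < q * b (e n) ∧ q * b (e n) < -1 - 1 / ((n : ℝ) + 2) := by
    intro n
    have hlt : -1 - 1 / ((n : ℝ) + 1) < -1 - 1 / ((n : ℝ) + 2) := by gcongr; norm_num
    have hneg : -1 - 1 / ((n : ℝ) + 2) < 0 := by
      have : 0 < 1 / ((n : ℝ) + 2) := by positivity
      linarith
    rcases lt_or_gt_of_ne (b.ne_zero (e n)) with hb | hb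
    · obtain ⟨q, hq₁, hq₂⟩ := exists_rat_btwn ((div_lt_div_right_of_neg hb).2 hlt)
      rw [div_lt_iff_of_neg hb] at hq₁
      rw [lt_div_iff_of_neg hb] at hq₂
      refine ⟨q, ?_, hq₂, hq₁⟩
      rintro rfl
      simp only [Rat.cast_zero, zero_mul] at hq₁
      linarith
    · obtain ⟨q, hq₁, hq₂⟩ := exists_rat_btwn ((div_lt_div_iff_of_pos_right hb).2 hlt)
      rw [div_lt_iff₀ hb] at hq₁
      rw [lt_div_iff₀ hb] at hq₂
      refine ⟨q, ?_, hq₁, hq₂⟩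
      rintro rfl
      simp only [Rat.cast_zero, zero_mul] at hq₂
      linarith
  choose q hq hlo hhi using hscale
  refine ⟨fun n => q n * b (e n), fun i => (q i)⁻¹ • b.coord (e i),
    strictMono_nat_of_lt_succ fun n => ?_, fun n => ?_, fun i j => ?_⟩
  · refine (hhi n).trans (lt_of_eq_of_lt ?_ (hlo (n + 1)))
    push_cast
    ring
  · have : 0 < 1 / ((n : ℝ) + 2) := by positivity
    linarith [hhi n]
  · have hmul : (q j : ℝ) * b (e j) = q j • b (e j) := (Rat.smul_def _ _).symm
    simp only [hmul, LinearMap.smul_apply, map_smul, Module.Basis.coord_apply,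
      Module.Basis.repr_self, Finsupp.single_apply, e.injective.eq_iff, smul_eq_mul]
    rcases eq_or_ne i j with rfl | h
    · simp [hq]
    · simp [h, h.symm]

/-- A finite sum of terms with distinct values has the value of one of its terms. -/
lemma AddValuation.exists_map_sum_eq {F ι : Type*} [Ring F] {Γ₀ : Type*}
    [LinearOrderedAddCommMonoidWithTop Γ₀]
    (v : AddValuation F Γ₀) (f : ι → F) {s : Finset ι}
    (hs : s.Nonempty) (hinj : Set.InjOn (fun i => v (f i)) s) :
    ∃ i ∈ s, v (∑ i ∈ s, f i) = v (f i) := by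
  classical
  induction hs using Finset.Nonempty.cons_induction with
  | singleton a => exact ⟨a, by simp⟩
  | cons a s ha hs ih =>
    obtain ⟨i, hi, hvi⟩ := ih (hinj.mono (by simp))
    rw [Finset.sum_cons]
    have hne : v (f a) ≠ v (∑ i ∈ s, f i) := fun h =>
      ha (hinj (by simp) (by simp [hi]) (h.trans hvi) ▸ hi)
    rw [v.map_add_of_distinct_val hne, hvi]
    rcases min_choice (v (f a)) (v (f i)) with h | h
    · exact ⟨a, by simp, h⟩
    · exact ⟨i, by simp [hi], h⟩

lemma AddValuation.map_eq_zero_of_pow_eq_self {F : Type*} [Field F]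
    (v : AddValuation F (WithTop ℝ)) {n : ℕ} (hn : 1 < n) {d : F} (hd : d ≠ 0) (h : d ^ n = d) :
    v d = 0 := by
  obtain ⟨r, hr⟩ := WithTop.ne_top_iff_exists.1 ((v.ne_top_iff).2 hd)
  have hv := v.map_pow d n
  rw [h, ← hr, ← WithTop.coe_nsmul, WithTop.coe_inj, nsmul_eq_mul] at hv
  have hn' : (1 : ℝ) < n := by exact_mod_cast hn
  have : r = 0 := by nlinarith
  rw [← hr, this, WithTop.coe_zero]

/-- A valuation taking `ℕ`-linearly independent values `ε i` on the `z i` takes values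
in the group generated by the `ε i` on the field generated by the `z i`. -/
lemma AddValuation.exists_mem_eq_of_mem_closure_range {F ι : Type*} [Field F] {p : ℕ}
    [Fact p.Prime] [CharP F p] (v : AddValuation F (WithTop ℝ)) {z : ι → F} {ε : ι → ℝ}
    (hz : ∀ i, v (z i) = ε i) (hε : LinearIndependent ℕ ε) {G : AddSubgroup ℝ}
    (hG : ∀ i, ε i ∈ G) {x : F} (hx : x ∈ Subfield.closure (Set.range z)) (hx0 : x ≠ 0) :
    ∃ r ∈ G, v x = (r : ℝ) := by
  let := ZMod.algebra F p
  have hcoeff : ∀ c : ZMod p, c ≠ 0 → v (algebraMap (ZMod p) F c) = 0 := fun c hc =>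
    v.map_eq_zero_of_pow_eq_self (n := p) (Nat.Prime.one_lt Fact.out) (by simpa using hc)
      (by rw [← _root_.map_pow, ZMod.pow_card])
  have hmon : ∀ d : ι →₀ ℕ, v (d.prod fun i n => z i ^ n) =
      ((Finsupp.linearCombination ℕ ε d : ℝ) : WithTop ℝ) := fun d => by
    induction d using Finsupp.induction_linear with
    | zero => simp
    | add d d' h h' =>
      rw [Finsupp.prod_add_index' (by simp) (by simp [pow_add]), v.map_mul, h, h', _root_.map_add,
        WithTop.coe_add]
    | single i n =>
      rw [Finsupp.prod_single_index (by simp), v.map_pow, hz, ← WithTop.coe_nsmul,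
        Finsupp.linearCombination_single]
  have hpoly : ∀ y ∈ Subring.closure (Set.range z), y ≠ 0 → ∃ r ∈ G, v y = (r : ℝ) := by
    intro y hy hy0
    have hle : Subring.closure (Set.range z) ≤
        (MvPolynomial.aeval (R := ZMod p) z).range.toSubring := by
      rw [Subring.closure_le]
      rintro _ ⟨i, rfl⟩
      exact ⟨MvPolynomial.X i, by simp⟩
    obtain ⟨f, rfl⟩ := hle hy
    have hf : f ≠ 0 := by rintro rfl; simp at hy0
    have hterm : ∀ d ∈ f.support, v (algebraMap (ZMod p) F (f.coeff d) *
        d.prod fun i n => z i ^ n) = ((Finsupp.linearCombination ℕ ε d : ℝ) : WithTop ℝ) :=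
      fun d hd => by
        rw [v.map_mul, hcoeff _ (MvPolynomial.mem_support_iff.1 hd), zero_add, hmon]
    obtain ⟨d, hd, hvd⟩ := v.exists_map_sum_eq
      (fun d => algebraMap (ZMod p) F (f.coeff d) * d.prod fun i n => z i ^ n)
      (s := f.support) (by simpa [Finset.nonempty_iff_ne_empty] using hf) (fun d hd d' hd' h => by
        simp only [hterm d hd, hterm d' hd', WithTop.coe_inj] at h
        exact hε h)
    refine ⟨Finsupp.linearCombination ℕ ε d, ?_, ?_⟩
    · rw [Finsupp.linearCombination_apply]
      exact G.sum_mem fun i _ => G.nsmul_mem (hG i) _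
    · rw [← hterm d hd, ← hvd]
      congr 1
  obtain ⟨y, hy, w, hw, rfl⟩ := Subfield.mem_closure_iff.1 hx
  obtain ⟨r, hr, hyr⟩ := hpoly y hy (by rintro rfl; simp at hx0)
  obtain ⟨s, hs, hws⟩ := hpoly w hw (by rintro rfl; simp at hx0)
  exact ⟨r - s, G.sub_mem hr hs, by
    rw [v.map_div, hyr, hws, ← WithTop.LinearOrderedAddCommGroup.coe_sub]⟩

section SumTail

variable {Γ : Type} [LinearOrder Γ] {p : ℕ} [Fact p.Prime]

open Classical in
variable (p) in
/-- The series `∑_{i ≥ n} t ^ g i`. -/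
noncomputable def HahnSeries.sumTail (g : ℕ → Γ) (hg : StrictMono g) (n : ℕ) :
    HahnSeries Γ (ZMod p) where
  coeff a := if a ∈ g '' Set.Ici n then 1 else 0
  isPWO_support' := by
    refine Set.IsPWO.mono (t := g '' Set.univ) ?_ ?_
    · exact (Set.isWF_univ_iff.2 inferInstance).isPWO.image_of_monotone hg.monotone
    · intro a ha
      by_contra h
      refine ha (if_neg fun h' => h (Set.image_mono (Set.subset_univ _) h'))

lemma HahnSeries.sumTail_orderTop (g : ℕ → Γ) (hg : StrictMono g) (n : ℕ) :
    (HahnSeries.sumTail p g hg n).orderTop = g n := by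
  refine HahnSeries.orderTop_eq_of_le ?_ ?_
  · have h : g n ∈ g '' Set.Ici n := ⟨n, Set.self_mem_Ici, rfl⟩
    exact (if_pos h).trans_ne one_ne_zero
  · intro a ha
    have h : a ∈ g '' Set.Ici n := by
      by_contra h
      exact ha (if_neg h)
    obtain ⟨i, hi, rfl⟩ := h
    exact hg.monotone hi

lemma HahnSeries.sumTail_eq_single_add (g : ℕ → Γ) (hg : StrictMono g) (n : ℕ) :
    HahnSeries.sumTail p g hg n =
      HahnSeries.single (g n) 1 + HahnSeries.sumTail p g hg (n + 1) := by
  ext a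
  simp only [HahnSeries.sumTail, HahnSeries.coeff_add, HahnSeries.coeff_single]
  by_cases h : a = g n
  · subst h
    have h1 : g n ∈ g '' Set.Ici n := ⟨n, Set.self_mem_Ici, rfl⟩
    have h2 : g n ∉ g '' Set.Ici (n + 1) := by
      rintro ⟨i, hi, h⟩
      have := hg.injective h
      simp only [Set.mem_Ici] at hi
      omega
    simp [h1, h2]
  · have h1 : a ∈ g '' Set.Ici n ↔ a ∈ g '' Set.Ici (n + 1) := by
      constructor
      · rintro ⟨i, hi, rfl⟩
        exact ⟨i, lt_of_le_of_ne hi fun h' => h (congrArg g h'.symm), rfl⟩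
      · rintro ⟨i, hi, rfl⟩
        exact ⟨i, (Nat.le_succ n).trans hi, rfl⟩
    rw [if_neg h, zero_add]
    classical exact if_congr h1 rfl rfl

end SumTail

section HahnSeries

variable {Γ : Type} [AddCommGroup Γ] [LinearOrder Γ] [IsOrderedAddMonoid Γ] {p : ℕ}
  [Fact p.Prime]

variable (p) in
/-- The real-valued valuation on Hahn series induced by an ordered embedding of the exponents. -/
noncomputable def HahnSeries.realVal (e : Γ →+ ℝ) (he : StrictMono e) :
    AddValuation (HahnSeries Γ (ZMod p)) (WithTop ℝ) :=
  (HahnSeries.addVal Γ (ZMod p)).map e.withTopMap rfl he.monotone.withTop_map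

lemma HahnSeries.realVal_of_orderTop_eq (e : Γ →+ ℝ) (he : StrictMono e)
    {x : HahnSeries Γ (ZMod p)} {a : Γ} (hx : x.orderTop = a) :
    HahnSeries.realVal p e he x = (e a : ℝ) := by
  change WithTop.map e (HahnSeries.addVal Γ (ZMod p) x) = _
  rw [HahnSeries.addVal_apply, hx]
  rfl

lemma HahnSeries.realVal_pos_iff (e : Γ →+ ℝ) (he : StrictMono e)
    {x : HahnSeries Γ (ZMod p)} : 0 < HahnSeries.realVal p e he x ↔ 0 < x.orderTop := by
  change 0 < WithTop.map e (HahnSeries.addVal Γ (ZMod p) x) ↔ _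
  rw [HahnSeries.addVal_apply]
  cases x.orderTop with
  | top => simp
  | coe a => rw [WithTop.map_coe, WithTop.coe_pos, WithTop.coe_pos, ← map_zero e, he.lt_iff_lt]

lemma HahnSeries.realVal_nonneg_iff (e : Γ →+ ℝ) (he : StrictMono e)
    {x : HahnSeries Γ (ZMod p)} : 0 ≤ HahnSeries.realVal p e he x ↔ 0 ≤ x.orderTop := by
  change 0 ≤ WithTop.map e (HahnSeries.addVal Γ (ZMod p) x) ↔ _
  rw [HahnSeries.addVal_apply]
  cases x.orderTop with
  | top => simp
  | coe a =>
    rw [WithTop.map_coe, WithTop.coe_nonneg, WithTop.coe_nonneg, ← map_zero e, he.le_iff_le]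

variable (p) in
/-- The field generated by `t ^ g i` for `i < n` and by `β ^ p - β` for `β = ∑_{i ≥ n} t ^ g i`. -/
noncomputable def HahnSeries.stageField (g : ℕ → Γ) (hg : StrictMono g) (n : ℕ) :
    Subfield (HahnSeries Γ (ZMod p)) :=
  Subfield.closure (((fun i => HahnSeries.single (g i) 1) '' Set.Iio n) ∪
    {HahnSeries.sumTail p g hg n ^ p - HahnSeries.sumTail p g hg n})

lemma HahnSeries.single_mem_stageField (g : ℕ → Γ) (hg : StrictMono g) {i n : ℕ} (h : i < n) :
    HahnSeries.single (g i) 1 ∈ HahnSeries.stageField p g hg n :=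
  Subfield.subset_closure (Or.inl ⟨i, h, rfl⟩)

lemma HahnSeries.sumTail_pow_sub_mem_stageField (g : ℕ → Γ) (hg : StrictMono g) (n : ℕ) :
    HahnSeries.sumTail p g hg n ^ p - HahnSeries.sumTail p g hg n ∈
      HahnSeries.stageField p g hg n :=
  Subfield.subset_closure (Or.inr rfl)

instance HahnSeries.charP_zmod : CharP (HahnSeries Γ (ZMod p)) p :=
  charP_of_injective_ringHom (HahnSeries.C_injective (Γ := Γ) (R := ZMod p)) p

lemma HahnSeries.stageField_mono (g : ℕ → Γ) (hg : StrictMono g) :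
    Monotone (HahnSeries.stageField p g hg) := by
  refine monotone_nat_of_le_succ fun n => ?_
  rw [HahnSeries.stageField, Subfield.closure_le, Set.union_subset_iff, Set.singleton_subset_iff]
  constructor
  · rintro _ ⟨i, hi, rfl⟩
    exact HahnSeries.single_mem_stageField g hg (Nat.lt_succ_of_lt hi)
  · have hx := HahnSeries.single_mem_stageField (p := p) g hg (Nat.lt_succ_self n)
    have hy := HahnSeries.sumTail_pow_sub_mem_stageField (p := p) g hg (n + 1)
    rw [HahnSeries.sumTail_eq_single_add, add_pow_char, add_sub_add_comm]
    exact add_mem (sub_mem (pow_mem hx p) hx) hy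

lemma HahnSeries.sumTail_zero_sub_mem_stageField (g : ℕ → Γ) (hg : StrictMono g) (n : ℕ) :
    HahnSeries.sumTail p g hg 0 - HahnSeries.sumTail p g hg n ∈
      HahnSeries.stageField p g hg n := by
  induction n with
  | zero => simp
  | succ n ih =>
    have h : HahnSeries.sumTail p g hg 0 - HahnSeries.sumTail p g hg (n + 1) =
        HahnSeries.sumTail p g hg 0 - HahnSeries.sumTail p g hg n +
          HahnSeries.single (g n) 1 := by
      rw [HahnSeries.sumTail_eq_single_add g hg n]
      ring
    rw [h]
    exact add_mem (HahnSeries.stageField_mono g hg n.le_succ ih)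
      (HahnSeries.single_mem_stageField g hg n.lt_succ_self)

/-- Values on the stage `n` field are never equal to the value of `∑_{i ≥ n} t ^ g i`. -/
lemma HahnSeries.realVal_ne_of_mem_stageField (e : Γ →+ ℝ) (he : StrictMono e) (g : ℕ → Γ)
    (hg : StrictMono g) (φ : ℕ → Module.Dual ℚ ℝ)
    (hφ : ∀ i j, φ i (e (g j)) = if i = j then 1 else 0) {n : ℕ} (hneg : e (g n) < 0)
    {c : HahnSeries Γ (ZMod p)} (hc : c ∈ HahnSeries.stageField p g hg n) :
    HahnSeries.realVal p e he c ≠ (e (g n) : ℝ) := by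
  rcases eq_or_ne c 0 with rfl | hc0
  · simp
  have hp : p.Prime := Fact.out
  have hp0 : (p : ℚ) ≠ 0 := by exact_mod_cast hp.ne_zero
  let v := HahnSeries.realVal p e he
  let z : ℕ → HahnSeries Γ (ZMod p) := fun i => if i = n then
    HahnSeries.sumTail p g hg n ^ p - HahnSeries.sumTail p g hg n else HahnSeries.single (g i) 1
  let u : ℕ → ℚˣ := fun i => if i = n then Units.mk0 (p : ℚ) hp0 else 1
  let ε : ℕ → ℝ := u • fun i => e (g i)
  have hεn : ε n = p * e (g n) := by simp [ε, u, Units.smul_def, Rat.smul_def]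
  have hεi : ∀ i, i ≠ n → ε i = e (g i) := fun i hi => by simp [ε, u, hi]
  have htail : v (HahnSeries.sumTail p g hg n) = (e (g n) : ℝ) :=
    HahnSeries.realVal_of_orderTop_eq e he (HahnSeries.sumTail_orderTop g hg n)
  have hz : ∀ i, v (z i) = (ε i : ℝ) := by
    intro i
    rcases eq_or_ne i n with rfl | hi
    · have hpow : v (HahnSeries.sumTail p g hg i ^ p) = (ε i : ℝ) := by
        rw [AddValuation.map_pow, htail, ← WithTop.coe_nsmul, nsmul_eq_mul, hεn]
      have hlt : v (HahnSeries.sumTail p g hg i ^ p) < v (HahnSeries.sumTail p g hg i) := by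
        rw [hpow, htail, WithTop.coe_lt_coe, hεn]
        have : (1 : ℝ) < p := by exact_mod_cast hp.one_lt
        nlinarith
      simp only [z, if_true]
      rw [AddValuation.map_sub_eq_of_lt_left _ hlt, hpow]
    · rw [hεi i hi]
      simp only [z, hi, if_false]
      exact HahnSeries.realVal_of_orderTop_eq e he (HahnSeries.orderTop_single one_ne_zero)
  have hγ : LinearIndependent ℚ fun i => e (g i) :=
    LinearIndependent.of_pairwise_dual_eq_zero_one _ φ
      (fun i j hij => (hφ i j).trans (if_neg hij)) fun i => (hφ i i).trans (if_pos rfl)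
  have hε : LinearIndependent ℕ ε := (hγ.units_smul u).restrict_scalars' ℕ
  let G : AddSubgroup ℝ := (AddSubgroup.zmultiples (p : ℚ)).comap (φ n).toAddMonoidHom
  have hG : ∀ i, ε i ∈ G := fun i => by
    rcases eq_or_ne i n with rfl | hi
    · rw [hεn, ← nsmul_eq_mul]
      exact AddSubgroup.mem_zmultiples_iff.2 ⟨1, by simp [hφ, -nsmul_eq_mul]⟩
    · rw [hεi i hi]
      exact AddSubgroup.mem_zmultiples_iff.2 ⟨0, by simp [hφ, hi.symm]⟩
  have hmem : c ∈ Subfield.closure (Set.range z) := by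
    refine Subfield.closure_mono ?_ hc
    rw [Set.union_subset_iff, Set.singleton_subset_iff]
    constructor
    · rintro _ ⟨i, hi, rfl⟩
      exact ⟨i, if_neg (ne_of_lt hi)⟩
    · exact ⟨n, if_pos rfl⟩
  obtain ⟨r, hr, hcr⟩ := v.exists_mem_eq_of_mem_closure_range hz hε hG hmem hc0
  change v c ≠ _
  rw [hcr, Ne, WithTop.coe_inj]
  rintro rfl
  obtain ⟨k, hk⟩ := AddSubgroup.mem_zmultiples_iff.1 hr
  have hk' : (k : ℚ) * p = 1 := by simpa [hφ] using hk
  have hk'' : k * (p : ℤ) = 1 := by exact_mod_cast hk'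
  exact hp.one_lt.ne'
    (by simpa using Int.isUnit_iff_natAbs_eq.1 (IsUnit.of_mul_eq_one_right k hk''))

end HahnSeries

/-- A subfield `K` of a valued field over which the whole field is immediate, with an
Artin-Schreier element over `K` all of whose distances to `K` are below `-1`. -/
lemma exists_subfield_artinSchreier (p : ℕ) [Fact p.Prime] :
    ∃ (F : Type) (_ : Field F) (_ : CharP F p) (v : AddValuation F (WithTop ℝ)) (K : Subfield F)
      (β : F), β ^ p - β ∈ K ∧ (∀ c ∈ K, v (β - c) < ((-1 : ℝ) : WithTop ℝ)) ∧
      (∀ x, x ≠ 0 → ∃ c ∈ K, v c = v x) ∧ ∀ x, 0 ≤ v x → ∃ c ∈ K, 0 < v (x - c) := by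
  obtain ⟨γ, φ, hγ, hlt, hφ⟩ := exists_strictMono_lt_neg_one_dual
  let Γ := AddSubgroup.closure (Set.range γ)
  let g : ℕ → Γ := fun i => ⟨γ i, AddSubgroup.subset_closure ⟨i, rfl⟩⟩
  have hg : StrictMono g := fun i j h => hγ h
  have he : StrictMono Γ.subtype := fun a b h => h
  let v := HahnSeries.realVal p Γ.subtype he
  let K : Subfield (HahnSeries Γ (ZMod p)) := ⨆ n, HahnSeries.stageField p g hg n
  have hle : ∀ n, HahnSeries.stageField p g hg n ≤ K := le_iSup _
  have hsingle : ∀ a : Γ, HahnSeries.single a (1 : ZMod p) ∈ K := by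
    rintro ⟨a, ha⟩
    induction ha using AddSubgroup.closure_induction with
    | mem a ha =>
      obtain ⟨i, rfl⟩ := ha
      exact hle (i + 1) (HahnSeries.single_mem_stageField g hg i.lt_succ_self)
    | zero => exact K.one_mem
    | add a b ha hb iha ihb =>
      have := K.mul_mem iha ihb
      rwa [HahnSeries.single_mul_single, one_mul] at this
    | neg a ha iha =>
      have := K.inv_mem iha
      rwa [HahnSeries.inv_single, inv_one] at this
  refine ⟨HahnSeries Γ (ZMod p), inferInstance, inferInstance, v, K, HahnSeries.sumTail p g hg 0,
    hle 0 (HahnSeries.sumTail_pow_sub_mem_stageField g hg 0), fun c hc => ?_, fun x hx => ?_,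
    fun x hx => ?_⟩
  · obtain ⟨n, hn⟩ := (Subfield.mem_iSup_of_directed
      (HahnSeries.stageField_mono g hg).directed_le).1 hc
    have hmem := sub_mem (HahnSeries.sumTail_zero_sub_mem_stageField (p := p) g hg n) hn
    have htail : v (HahnSeries.sumTail p g hg n) = (γ n : ℝ) :=
      HahnSeries.realVal_of_orderTop_eq _ he (HahnSeries.sumTail_orderTop g hg n)
    have hne := HahnSeries.realVal_ne_of_mem_stageField Γ.subtype he g hg φ hφ
      (n := n) ((hlt n).trans (by norm_num)) hmem
    have hsplit : HahnSeries.sumTail p g hg 0 - c = HahnSeries.sumTail p g hg n +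
        (HahnSeries.sumTail p g hg 0 - HahnSeries.sumTail p g hg n - c) := by ring
    rw [hsplit, v.map_add_of_distinct_val (htail.trans_ne hne.symm)]
    refine (min_le_left _ _).trans_lt ?_
    rw [htail, WithTop.coe_lt_coe]
    exact hlt n
  · refine ⟨HahnSeries.single x.order 1, hsingle _, ?_⟩
    exact (HahnSeries.realVal_of_orderTop_eq _ he (HahnSeries.orderTop_single one_ne_zero)).trans
      (HahnSeries.realVal_of_orderTop_eq _ he
        (HahnSeries.order_eq_orderTop_of_ne_zero hx).symm).symm
  · have hC : HahnSeries.C (x.coeff 0) ∈ K := by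
      rw [← ZMod.natCast_zmod_val (x.coeff 0), map_natCast]
      exact natCast_mem K _
    refine ⟨_, hC, (HahnSeries.realVal_pos_iff _ he).2 ?_⟩
    have hx' := (HahnSeries.realVal_nonneg_iff _ he).1 hx
    refine lt_of_le_of_ne ?_ fun h => ?_
    · refine HahnSeries.le_orderTop_iff_forall.2 fun a ha => ?_
      have ha0 : a ≠ 0 := by rintro rfl; simp at ha
      rw [HahnSeries.coeff_sub, HahnSeries.C_apply, HahnSeries.coeff_single_of_ne ha0, sub_zero]
      exact HahnSeries.coeff_eq_zero_of_lt_orderTop (ha.trans_le hx')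
    · refine HahnSeries.coeff_orderTop_ne (g := 0) h.symm ?_
      simp [HahnSeries.C_apply]

open Polynomial in
/-- The statement for a subfield `K` of a field `F` of characteristic `p`, immediate below `F`. -/
lemma statement9Prop_of_subfield {p : ℕ} [Fact p.Prime] {F : Type} [Field F] [CharP F p]
    (v : AddValuation F (WithTop ℝ)) (K : Subfield F) {β : F} (hβ : β ^ p - β ∈ K)
    (hdist : ∀ c ∈ K, v (β - c) < ((-1 : ℝ) : WithTop ℝ))
    (hval : ∀ x, x ≠ 0 → ∃ c ∈ K, v c = v x)
    (hres : ∀ x, 0 ≤ v x → ∃ c ∈ K, 0 < v (x - c)) : Statement9Prop p K := by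
  have hp : p.Prime := Fact.out
  have hchar : CharP K p := (RingHom.charP_iff K.subtype Subtype.val_injective p).2 inferInstance
  have hβneg : v β < 0 := by
    have h := hdist 0 K.zero_mem
    rw [sub_zero] at h
    exact h.trans (by rw [← WithTop.coe_zero, WithTop.coe_lt_coe]; norm_num)
  obtain ⟨Ω, _, _, j, w, hw⟩ := v.exists_extension_isAlgClosed hβneg
  let : Algebra K Ω := (j.comp K.subtype).toAlgebra
  let jK : F →ₐ[K] Ω := { j with commutes' := fun _ => rfl }
  have hjK : ∀ x, w (jK x) = v x := hw
  let ι : AlgebraicClosure K →ₐ[K] Ω := IsAlgClosed.lift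
  let V := w.comap ι.toRingHom
  have hV : ∀ x, V x = w (ι x) := fun _ => rfl
  have hι : ∀ c : K, ι (algebraMap K _ c) = jK c := fun c =>
    (ι.commutes c).trans (jK.commutes c).symm
  let a : K := ⟨β ^ p - β, hβ⟩
  let f : K[X] := X ^ p - (X + C a)
  have hf : f.Monic := monic_X_pow_sub (by
    rw [degree_X_add_C]; exact_mod_cast hp.one_lt)
  have hint : IsIntegral K (jK β) := ⟨f, hf, by
    have : jK β ^ p - jK β = algebraMap K Ω a := by
      rw [← map_pow, ← map_sub]
      rfl
    simp only [f, eval₂_sub, eval₂_pow, eval₂_add, eval₂_X, eval₂_C, ← this]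
    ring⟩
  obtain ⟨b, hb⟩ := hint.mem_range_algHom_of_minpoly_splits (IsAlgClosed.splits _) ι
  replace hb : ι b = jK β := hb
  have hba : b ^ p - b = algebraMap K _ a := ι.injective <| by
    change ι _ = ι _
    rw [map_sub, map_pow, hb, hι, ← map_pow, ← map_sub]
  have hadj : ∀ x ∈ IntermediateField.adjoin K {b}, ∃ y, ι x = jK y := by
    have hle : IntermediateField.adjoin K {b} ≤ jK.fieldRange.comap ι := by
      rw [IntermediateField.adjoin_simple_le_iff]
      exact ⟨β, hb.symm⟩
    intro x hx
    obtain ⟨y, hy⟩ := hle hx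
    exact ⟨y, hy.symm⟩
  refine ⟨hchar, V, b, ?_, ⟨a, hba.symm⟩, Set.Subset.antisymm ?_ ?_, ?_, ?_, ?_⟩
  · rintro ⟨c, rfl⟩
    have hc : (c : F) = β := jK.injective ((hι c).symm.trans hb)
    simpa [hc] using hdist c c.2
  · rintro _ ⟨x, hx, hx0, rfl⟩
    obtain ⟨y, hy⟩ := hadj x hx
    obtain ⟨c, hc, hcy⟩ := hval y (by
      rintro rfl
      exact hx0 (ι.injective (by simpa using hy)))
    have hVc : V (algebraMap K _ ⟨c, hc⟩) = V x := by rw [hV, hV, hι, hy, hjK, hjK, hcy]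
    refine ⟨⟨c, hc⟩, fun h => hx0 ?_, hVc⟩
    rwa [h, map_zero, V.map_zero, eq_comm, V.top_iff] at hVc
  · rintro _ ⟨c, hc, rfl⟩
    exact ⟨_, IntermediateField.algebraMap_mem _ c, by simpa using hc, rfl⟩
  · intro x hx hx0
    obtain ⟨y, hy⟩ := hadj x hx
    rw [hV, hy, hjK] at hx0
    obtain ⟨c, hc, hcy⟩ := hres y hx0
    refine ⟨⟨c, hc⟩, ?_⟩
    rwa [hV, map_sub, hι, hy, ← map_sub, hjK]
  · intro b' hb' hne
    refine V.map_eq_zero_of_pow_eq_self hp.one_lt (sub_ne_zero.2 hne) ?_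
    have hdvd : minpoly K b ∣ f := minpoly.dvd _ _ (by
      simp only [f, map_sub, map_pow, map_add, aeval_X, aeval_C, ← hba]
      ring)
    have hb'a := aeval_eq_zero_of_dvd_aeval_eq_zero hdvd hb'
    simp only [f, map_sub, map_pow, map_add, aeval_X, aeval_C, ← hba] at hb'a
    have : CharP (AlgebraicClosure K) p := charP_of_injective_algebraMap' K p
    rw [sub_pow_char]
    linear_combination hb'a
  · intro c
    rw [hV, map_sub, hb, hι, ← map_sub, hjK]
    exact hdist c c.2

/-- For every prime `p` there exist a field `K` of characteristic `p`, a
valuation with value group inside `ℝ` on an algebraic closure of `K`, and an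
Artin–Schreier element `β` over `K` generating an immediate extension, with
`v(β' - β) = 0` for every conjugate `β' ≠ β` and `v(β - c) < -1` for all `c ∈ K`;  hence
`δ(β) ≤ (-1)⁻ < 0⁻ = ω(β)⁻`. -/
theorem statement9 (p : ℕ) (hp : p.Prime) :
    ∃ (K : Type) (fK : Field K), @Statement9Prop p K fK := by
  have : Fact p.Prime := ⟨hp⟩
  obtain ⟨F, _, _, v, K, β, hβ, hdist, hval, hres⟩ := exists_subfield_artinSchreier p
  exact ⟨K, inferInstance, statement9Prop_of_subfield v K hβ hdist hval hres⟩
end
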